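/- arXiv:1505.03312 — 4 statements merged into one kernel-verified Lean document; each statement's English description precedes it below -/
import Mathlib

section
/- For every c ∈ ℂ, the free ℂ[∂]-module CL_1(c) = ⊕_{i ≥ −1} ℂ[∂]L_i with λ-bracket [L_i λ L_j] = ((i+1)∂ + (i+j+2)λ) L_{i+j} + c(j−i) L_{i+j}, extended by conformal sesquilinearity, is a simple Lie conformal algebra. -/
set_option maxSynthPendingDepth 3

namespace QLCA

variable {V : Type} [AddCommGroup V] [Module ℂ V]

/-- Bilinearity over `ℂ` of a binary product. -/
def IsBilin (f : V → V → V) : Prop :=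
  (∀ x y z : V, f (x + y) z = f x z + f y z) ∧
  (∀ x y z : V, f x (y + z) = f x y + f x z) ∧
  (∀ (c : ℂ) (x y : V), f (c • x) y = c • f x y) ∧
  (∀ (c : ℂ) (x y : V), f x (c • y) = c • f x y)

/-- `(V, f)` is a Novikov algebra over `ℂ`. -/
def IsNovikov (f : V → V → V) : Prop :=
  IsBilin f ∧
  (∀ a b c : V, f (f a b) c - f a (f b c) = f (f b a) c - f b (f a c)) ∧
  (∀ a b c : V, f (f a b) c = f (f a c) b)

/-- `I` is an ideal of the Novikov algebra `(V, f)`. -/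
def IsNovikovIdeal (f : V → V → V) (I : Submodule ℂ V) : Prop :=
  ∀ a ∈ I, ∀ b : V, f a b ∈ I ∧ f b a ∈ I

/-- The Novikov algebra `(V, f)` is simple. -/
def NovikovSimple (f : V → V → V) : Prop :=
  (∃ a b : V, f a b ≠ 0) ∧
  ∀ I : Submodule ℂ V, IsNovikovIdeal f I → I = ⊥ ∨ I = ⊤

/-- `(V, f)` is a Lie algebra over `ℂ`. -/
def IsLieBracket (f : V → V → V) : Prop :=
  IsBilin f ∧
  (∀ a b : V, f a b = - f b a) ∧
  (∀ a b c : V, f a (f b c) = f (f a b) c + f b (f a c))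

/-- The Gel'fand-Dorfman compatibility condition between a Novikov product and
a Lie bracket. -/
def GDcompat (mul lie : V → V → V) : Prop :=
  ∀ a b c : V,
    lie (mul a b) c - lie (mul a c) b + mul (lie a b) c - mul (lie a c) b
      - mul a (lie b c) = 0

/-- `(V, mul, lie)` is a Gel'fand-Dorfman bialgebra. -/
def IsGD (mul lie : V → V → V) : Prop :=
  IsNovikov mul ∧ IsLieBracket lie ∧ GDcompat mul lie

/-- `I` is a Gel'fand-Dorfman ideal of `(V, mul, lie)`. -/
def IsGDIdeal (mul lie : V → V → V) (I : Submodule ℂ V) : Prop :=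
  IsNovikovIdeal mul I ∧ ∀ a ∈ I, ∀ b : V, lie a b ∈ I ∧ lie b a ∈ I

/-- The symmetrized (Novikov-Jordan) product `a ∗ b = a∘b + b∘a`. -/
def sProd (mul : V → V → V) (a b : V) : V := mul a b + mul b a

/-- `I` is an ideal of the Novikov-Jordan algebra `(V, ∗)`. -/
def IsNJIdeal (mul : V → V → V) (I : Submodule ℂ V) : Prop :=
  ∀ a ∈ I, ∀ b : V, sProd mul a b ∈ I

/-- The Novikov-Jordan algebra `(V, ∗)` is simple. -/
def NJSimple (mul : V → V → V) : Prop :=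
  (∃ a b : V, sProd mul a b ≠ 0) ∧
  ∀ I : Submodule ℂ V, IsNJIdeal mul I → I = ⊥ ∨ I = ⊤

/-- An element of the free module `R = ℂ[∂]V`, recorded by its coefficients:
`a : Conf V` represents `∑ₘ ∂^m (a m)`. -/
abbrev Conf (V : Type) [Zero V] := ℕ →₀ V

/-- A polynomial in `λ` with coefficients in `R = ℂ[∂]V`: `P : LP V`
represents `∑ₙ λ^n (P n)`. -/
abbrev LP (V : Type) [Zero V] := ℕ →₀ (ℕ →₀ V)

/-- Multiplication by `∂` on `ℂ[∂]V`. -/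
noncomputable def Dop (a : Conf V) : Conf V := Finsupp.mapDomain (· + 1) a

/-- Multiplication by `λ` on `λ`-polynomials. -/
noncomputable def lmul (P : LP V) : LP V := Finsupp.mapDomain (· + 1) P

/-- Multiplication by `∂` on `λ`-polynomials. -/
noncomputable def dmul (P : LP V) : LP V := Finsupp.mapRange (Dop (V := V)) (by simp [Dop]) P

/-- Multiplication by `λ + ∂` on `λ`-polynomials. -/
noncomputable def ldOp (P : LP V) : LP V := lmul P + dmul P

/-- The `λ`-bracket on `R = ℂ[∂]V` obtained from the generator values `B u v`
(`u, v ∈ V`) by extension via `ℂ`-bilinearity and conformal sesquilinearity: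
`[(∂^m u) λ (∂^n v)] = (-λ)^m (λ+∂)^n [u λ v]`. -/
noncomputable def qbr (B : V → V → LP V) (a b : Conf V) : LP V :=
  Finsupp.sum a fun m am => Finsupp.sum b fun n bn =>
    ((-1 : ℂ) ^ m) • (lmul (V := V))^[m] ((ldOp (V := V))^[n] (B am bn))

/-- The substitution `λ ↦ -λ-∂` in a `λ`-polynomial
(used to express skew-symmetry `[a λ b] = -[b (-λ-∂) a]`). -/
noncomputable def nsubst (P : LP V) : LP V :=
  Finsupp.sum P fun n cn => ((-1 : ℂ) ^ n) • (ldOp (V := V))^[n] (Finsupp.single 0 cn)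

/-- `I` is an ideal of `R = ℂ[∂]V` with `λ`-bracket `qbr B`: a
`ℂ[∂]`-submodule (a `ℂ`-submodule closed under `∂`) such that every
`λ`-coefficient of `[a λ x]` lies in `I` for all `a ∈ R`, `x ∈ I`. -/
def IsConfIdeal (B : V → V → LP V) (I : Submodule ℂ (Conf V)) : Prop :=
  (∀ x ∈ I, Dop x ∈ I) ∧
  (∀ a : Conf V, ∀ x ∈ I, ∀ n : ℕ, qbr B a x n ∈ I)

/-- The conformal algebra `R = ℂ[∂]V` with `λ`-bracket `qbr B` is simple:
its `λ`-bracket is not identically zero and its only ideals are `0` and `R`. -/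
def ConfSimple (B : V → V → LP V) : Prop :=
  (∃ a b : Conf V, qbr B a b ≠ 0) ∧
  ∀ I : Submodule ℂ (Conf V), IsConfIdeal B I → I = ⊥ ∨ I = ⊤

/-- `R = ℂ[∂]V` with the `λ`-bracket `qbr B` is a Lie conformal algebra: the
bracket is `ℂ`-bilinear, satisfies conformal sesquilinearity, skew-symmetry
`[a λ b] = -[b (-λ-∂) a]`, and the Jacobi identity
`[a λ [b μ c]] = [[a λ b] (λ+μ) c] + [b μ [a λ c]]` (the latter written out by
comparing the coefficients of `λ^p μ^q` on both sides). -/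
def IsLieConf (B : V → V → LP V) : Prop :=
  (∀ a b c : Conf V, qbr B (a + b) c = qbr B a c + qbr B b c) ∧
  (∀ a b c : Conf V, qbr B a (b + c) = qbr B a b + qbr B a c) ∧
  (∀ (k : ℂ) (a b : Conf V), qbr B (k • a) b = k • qbr B a b) ∧
  (∀ (k : ℂ) (a b : Conf V), qbr B a (k • b) = k • qbr B a b) ∧
  (∀ a b : Conf V, qbr B (Dop a) b = - lmul (qbr B a b)) ∧
  (∀ a b : Conf V, qbr B a (Dop b) = ldOp (qbr B a b)) ∧
  (∀ a b : Conf V, qbr B a b = - nsubst (qbr B b a)) ∧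
  (∀ a b c : Conf V, ∀ p q : ℕ,
    qbr B a (qbr B b c q) p =
      (∑ n ∈ Finset.Icc q (p + q),
        (n.choose q : ℂ) • qbr B (qbr B a b (p + q - n)) c n)
      + qbr B b (qbr B a c p) q)

/-- Generator values of the `λ`-bracket of the quadratic Lie conformal algebra
associated to a Gel'fand-Dorfman bialgebra `(V, mul, lie)`:
`[u λ v] = ∂(v∘u) + [v,u] + λ(u∘v + v∘u)`. -/
noncomputable def gdB (mul lie : V → V → V) (u v : V) : LP V :=
  Finsupp.single 0 (Finsupp.single 1 (mul v u) + Finsupp.single 0 (lie v u))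
    + Finsupp.single 1 (Finsupp.single 0 (mul u v + mul v u))

end QLCA

open QLCA

/-- The basis vector `L_n` of `A₁` for `n ≥ -1` (and `0` for `n < -1`). -/
noncomputable def sL (n : ℤ) : {i : ℤ // (-1 : ℤ) ≤ i} →₀ ℂ :=
  if h : (-1 : ℤ) ≤ n then Finsupp.single ⟨n, h⟩ 1 else 0

/-- The Novikov product of `A₁`: `L_i ∘ L_j = (j+1) L_{i+j}`, extended
bilinearly. -/
noncomputable def A1mul (u v : {i : ℤ // (-1 : ℤ) ≤ i} →₀ ℂ) :
    {i : ℤ // (-1 : ℤ) ≤ i} →₀ ℂ :=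
  Finsupp.sum u fun i ui => Finsupp.sum v fun j vj =>
    (ui * vj * ((j.1 : ℂ) + 1)) • sL (i.1 + j.1)

/-- Generator values of the `λ`-bracket of `CL₁(c)`:
`[L_i λ L_j] = ((i+1)∂ + (i+j+2)λ) L_{i+j} + c(j−i) L_{i+j}`,
extended bilinearly. -/
noncomputable def B1 (c : ℂ) (u v : {i : ℤ // (-1 : ℤ) ≤ i} →₀ ℂ) :
    ℕ →₀ (ℕ →₀ ({i : ℤ // (-1 : ℤ) ≤ i} →₀ ℂ)) :=
  Finsupp.sum u fun i ui => Finsupp.sum v fun j vj => (ui * vj) •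
    (Finsupp.single 0
        (Finsupp.single 1 (((i.1 : ℂ) + 1) • sL (i.1 + j.1))
          + Finsupp.single 0 ((c * ((j.1 : ℂ) - (i.1 : ℂ))) • sL (i.1 + j.1)))
      + Finsupp.single 1
          (Finsupp.single 0 (((i.1 : ℂ) + (j.1 : ℂ) + 2) • sL (i.1 + j.1))))

set_option linter.unusedSectionVars false
set_option linter.unusedSimpArgs false

namespace QLCA

section gen
variable {V : Type} [AddCommGroup V] [Module ℂ V]

lemma Dop_add (a b : Conf V) : Dop (a + b) = Dop a + Dop b := Finsupp.mapDomain_add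
lemma Dop_smul (k : ℂ) (a : Conf V) : Dop (k • a) = k • Dop a := Finsupp.mapDomain_smul k a
lemma Dop_zero : Dop (0 : Conf V) = 0 := Finsupp.mapDomain_zero
lemma Dop_neg (a : Conf V) : Dop (-a) = -Dop a := by
  have := Dop_smul (-1) a
  simpa using this
lemma Dop_single (m : ℕ) (v : V) : Dop (Finsupp.single m v) = Finsupp.single (m + 1) v :=
  Finsupp.mapDomain_single
lemma lmul_add (a b : LP V) : lmul (a + b) = lmul a + lmul b := Finsupp.mapDomain_add
lemma lmul_smul (k : ℂ) (a : LP V) : lmul (k • a) = k • lmul a := Finsupp.mapDomain_smul k a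
lemma lmul_succ (P : LP V) (n : ℕ) : lmul P (n + 1) = P n :=
  Finsupp.mapDomain_apply (f := fun n : ℕ => n + 1) (add_left_injective 1) P n
lemma lmul_z (P : LP V) : lmul P 0 = 0 := by
  apply Finsupp.mapDomain_of_notMem_range
  simp
lemma lmul_single (n : ℕ) (x : Conf V) :
    lmul (Finsupp.single n x) = Finsupp.single (n + 1) x := Finsupp.mapDomain_single
lemma dmul_apply (P : LP V) (n : ℕ) : dmul P n = Dop (P n) := Finsupp.mapRange_apply ..
lemma ldOp_succ (P : LP V) (n : ℕ) : ldOp P (n + 1) = P n + Dop (P (n + 1)) := by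
  simp [ldOp, lmul_succ, dmul_apply]
lemma ldOp_z (P : LP V) : ldOp P 0 = Dop (P 0) := by
  simp [ldOp, lmul_z, dmul_apply]
lemma ldOp_add (a b : LP V) : ldOp (a + b) = ldOp a + ldOp b := by
  ext n : 1
  cases n <;> simp [ldOp_succ, ldOp_z, Dop_add]
  abel
lemma ldOp_smul (k : ℂ) (a : LP V) : ldOp (k • a) = k • ldOp a := by
  ext n : 1
  cases n <;> simp [ldOp_succ, ldOp_z, Dop_smul]
lemma lmul_ldOp (a : LP V) : lmul (ldOp a) = ldOp (lmul a) := by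
  ext n : 1
  rcases n with _ | _ | n <;> simp [ldOp_succ, ldOp_z, lmul_succ, lmul_z, Dop_zero]

variable (V) in
/-- `∂` on `R` as a linear map. -/
noncomputable def DL : Conf V →ₗ[ℂ] Conf V := ⟨⟨Dop, Dop_add⟩, Dop_smul⟩
variable (V) in
/-- `λ` as a linear map. -/
noncomputable def lL : LP V →ₗ[ℂ] LP V := ⟨⟨lmul, lmul_add⟩, lmul_smul⟩
variable (V) in
/-- `λ + ∂` as a linear map. -/
noncomputable def ldL : LP V →ₗ[ℂ] LP V := ⟨⟨ldOp, ldOp_add⟩, ldOp_smul⟩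

lemma lmul_it (m : ℕ) (P : LP V) : (lmul (V := V))^[m] P = (lL V ^ m) P := by
  rw [Module.End.pow_apply]; rfl
lemma ldOp_it (m : ℕ) (P : LP V) : (ldOp (V := V))^[m] P = (ldL V ^ m) P := by
  rw [Module.End.pow_apply]; rfl

lemma comm_ll : Commute (lL V) (ldL V) := by
  apply LinearMap.ext
  intro x
  exact lmul_ldOp x

/-- `qbr` rewritten with linear maps -/
lemma qbr_eq (B : V → V → LP V) (a b : Conf V) : qbr B a b =
    a.sum fun m am => b.sum fun n bn =>
      ((-1 : ℂ) ^ m) • (lL V ^ m) ((ldL V ^ n) (B am bn)) := by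
  simp only [qbr, lmul_it, ldOp_it]

variable (B : V →ₗ[ℂ] V →ₗ[ℂ] LP V)

/-- bilinear version of the bracket -/
noncomputable def Q : Conf V →ₗ[ℂ] Conf V →ₗ[ℂ] LP V :=
  LinearMap.mk₂ ℂ (qbr (fun u v => B u v))
    (by
      intro a b c
      simp only [qbr_eq]
      apply Finsupp.sum_add_index' <;> simp [Finsupp.sum_add])
    (by
      intro k a b
      simp only [qbr_eq]
      rw [Finsupp.sum_smul_index']
      · rw [Finsupp.smul_sum]
        simp only [Finsupp.smul_sum, map_smul, LinearMap.smul_apply]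
        simp only [smul_comm k]
      · simp)
    (by
      intro a b c
      simp only [qbr_eq]
      rw [← Finsupp.sum_add]
      congr 1; ext1 m; ext1 am
      apply Finsupp.sum_add_index' <;> simp)
    (by
      intro k a b
      simp only [qbr_eq]
      rw [Finsupp.smul_sum]
      congr 1; ext1 m; ext1 am
      rw [Finsupp.sum_smul_index', Finsupp.smul_sum]
      · simp only [map_smul]
        simp only [smul_comm k]
      · simp)

lemma Q_single (m n : ℕ) (u v : V) : Q B (.single m u) (.single n v) =
    ((-1 : ℂ) ^ m) • (lL V ^ m) ((ldL V ^ n) (B u v)) := by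
  change qbr (fun u v => B u v) (.single m u) (.single n v) = _
  rw [qbr_eq, Finsupp.sum_single_index, Finsupp.sum_single_index]
  · simp
  · simp

lemma Q_D_left (a b : Conf V) : Q B (Dop a) b = - lmul (Q B a b) := by
  change Q B (DL V a) b = - lL V (Q B a b)
  induction a using Finsupp.induction_linear with
  | zero => simp
  | add f g hf hg => simp only [map_add, LinearMap.add_apply, hf, hg]; abel
  | single m u =>
    induction b using Finsupp.induction_linear with
    | zero => simp
    | add f g hf hg => simp only [map_add, hf, hg]; abel
    | single n v =>
      rw [show DL V (.single m u) = .single (m + 1) u from Dop_single m u, Q_single, Q_single,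
        pow_succ' (lL V)]
      simp [pow_succ]

lemma Q_D_right (a b : Conf V) : Q B a (Dop b) = ldOp (Q B a b) := by
  change Q B a (DL V b) = ldL V (Q B a b)
  induction a using Finsupp.induction_linear with
  | zero => simp
  | add f g hf hg => simp only [map_add, LinearMap.add_apply, hf, hg]
  | single m u =>
    induction b using Finsupp.induction_linear with
    | zero => simp
    | add f g hf hg => simp only [map_add, hf, hg]
    | single n v =>
      rw [show DL V (.single n v) = .single (n + 1) v from Dop_single n v, Q_single, Q_single,
        pow_succ' (ldL V), map_smul, ← Module.End.mul_apply (ldL V),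
        ← ((comm_ll (V := V)).pow_left m).eq]
      rfl

/-- linear substitution -/
noncomputable def NL : LP V →ₗ[ℂ] LP V where
  toFun := nsubst
  map_add' a b := by
    simp only [nsubst, ldOp_it]
    apply Finsupp.sum_add_index' <;> simp
  map_smul' k a := by
    simp only [nsubst, ldOp_it, RingHom.id_apply]
    rw [Finsupp.sum_smul_index', Finsupp.smul_sum]
    · simp only [← Finsupp.smul_single, map_smul, smul_comm k]
    · simp

lemma NL_single (n : ℕ) (x : Conf V) :
    NL (.single n x) = ((-1 : ℂ) ^ n) • (ldL V ^ n) (.single 0 x) := by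
  show nsubst _ = _
  simp only [nsubst, ldOp_it]
  rw [Finsupp.sum_single_index]; simp

lemma NL_l (P : LP V) : NL (lL V P) = - ldL V (NL P) := by
  induction P using Finsupp.induction_linear with
  | zero => simp
  | add f g hf hg => simp only [map_add, hf, hg]; abel
  | single n x =>
    rw [show lL V (.single n x) = .single (n + 1) x from lmul_single n x, NL_single, NL_single,
      pow_succ' (ldL V)]
    simp [pow_succ]

lemma ldL_single (n : ℕ) (x : Conf V) :
    ldL V (.single n x) = .single (n + 1) x + .single n (Dop x) := by
  show ldOp _ = _
  simp [ldOp, lmul_single, dmul]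

lemma NL_ld (P : LP V) : NL (ldL V P) = - lL V (NL P) := by
  induction P using Finsupp.induction_linear with
  | zero => simp
  | add f g hf hg => simp only [map_add, hf, hg]; abel
  | single n x =>
    have h1 : (ldL V ^ n) (.single 0 (Dop x)) = (ldL V ^ (n + 1)) (.single 0 x)
        - lL V ((ldL V ^ n) (.single 0 x)) := by
      rw [← Module.End.mul_apply (lL V), ((comm_ll (V := V)).pow_right n).eq, pow_succ]
      rw [Module.End.mul_apply, Module.End.mul_apply, ← map_sub, ldL_single,
        show lL V (.single 0 x) = .single (0 + 1) x from lmul_single 0 x]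
      simp
    rw [ldL_single, map_add, NL_single, NL_single, NL_single, h1, map_smul, pow_succ (-1 : ℂ)]
    module

/-- induction principle on `R` -/
lemma conf_ind {p : Conf V → Prop} (S : Set V) (hS : Submodule.span ℂ S = ⊤) (h0 : p 0)
    (hadd : ∀ a b, p a → p b → p (a + b)) (hsm : ∀ (k : ℂ) a, p a → p (k • a))
    (hD : ∀ a, p a → p (Dop a))
    (hs : ∀ v ∈ S, p (.single 0 v)) (a : Conf V) : p a := by
  induction a using Finsupp.induction_linear with
  | zero => exact h0
  | add f g hf hg => exact hadd _ _ hf hg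
  | single m v =>
    induction m with
    | succ m ih => rw [← Dop_single]; exact hD _ ih
    | zero =>
      have : v ∈ Submodule.span ℂ S := hS ▸ Submodule.mem_top
      induction this using Submodule.span_induction with
      | mem x h => exact hs x h
      | zero => simpa using h0
      | add x y _ _ hx hy => rw [Finsupp.single_add]; exact hadd _ _ hx hy
      | smul k x _ hx => rw [← Finsupp.smul_single]; exact hsm _ _ hx

lemma skew (S : Set V) (hS : Submodule.span ℂ S = ⊤)
    (h : ∀ u ∈ S, ∀ v ∈ S, Q B (.single 0 u) (.single 0 v)
      = - NL (Q B (.single 0 v) (.single 0 u))) (a b : Conf V) :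
    Q B a b = - NL (Q B b a) := by
  induction a using conf_ind S hS with
  | h0 => simp
  | hadd x y hx hy => simp only [map_add, LinearMap.add_apply, hx, hy]; abel
  | hsm k x hx => simp only [map_smul, LinearMap.smul_apply, hx, smul_neg]
  | hD x hx =>
    rw [Q_D_left, Q_D_right, hx]
    change - lL V (- _) = - NL (ldL V _)
    rw [NL_ld]; simp
  | hs u hu =>
    induction b using conf_ind S hS with
    | h0 => simp
    | hadd x y hx hy => simp only [map_add, LinearMap.add_apply, hx, hy]; abel
    | hsm k x hx => simp only [map_smul, LinearMap.smul_apply, hx, smul_neg]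
    | hD x hx =>
      rw [Q_D_left, Q_D_right, hx]
      change ldL V (- _) = - NL (- lL V _)
      rw [map_neg NL, NL_l]; simp
    | hs v hv => exact h u hu v hv


/-- shift of a sequence -/
def sh {W : Type} [Zero W] (f : ℕ → W) : ℕ → W
  | 0 => 0
  | n + 1 => f n

lemma sh_z {W : Type} [Zero W] (f : ℕ → W) : sh f 0 = 0 := rfl
lemma sh_s {W : Type} [Zero W] (f : ℕ → W) (n : ℕ) : sh f (n + 1) = f n := rfl

/-- middle term of the Jacobi identity -/
noncomputable def MM (T : ℕ → ℕ → Conf V) (p q : ℕ) : Conf V :=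
  ∑ x ∈ Finset.HasAntidiagonal.antidiagonal (p + q), (x.2.choose q : ℂ) • T x.1 x.2

lemma MM_eq (T : ℕ → ℕ → Conf V) (p q : ℕ) :
    ∑ n ∈ Finset.Icc q (p + q), (n.choose q : ℂ) • T (p + q - n) n = MM T p q := by
  rw [MM, ← Finset.Nat.sum_antidiagonal_swap]
  simp only [Prod.fst_swap, Prod.snd_swap]
  rw [Finset.Nat.sum_antidiagonal_eq_sum_range_succ_mk]
  apply Finset.sum_subset
  · intro n hn
    simp at hn ⊢; omega
  · intro n hn hn'
    have : n < q := by simp at hn hn'; omega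
    simp [Nat.choose_eq_zero_of_lt this]

lemma MM_add (T T' : ℕ → ℕ → Conf V) (p q : ℕ) :
    MM (fun r n => T r n + T' r n) p q = MM T p q + MM T' p q := by
  simp [MM, Finset.sum_add_distrib]
lemma MM_smul (k : ℂ) (T : ℕ → ℕ → Conf V) (p q : ℕ) :
    MM (fun r n => k • T r n) p q = k • MM T p q := by
  simp only [MM, Finset.smul_sum, smul_comm k]
lemma MM_neg (T : ℕ → ℕ → Conf V) (p q : ℕ) :
    MM (fun r n => - T r n) p q = - MM T p q := by
  simp [MM]
lemma MM_D (T : ℕ → ℕ → Conf V) (p q : ℕ) :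
    MM (fun r n => Dop (T r n)) p q = Dop (MM T p q) := by
  change _ = DL V _
  simp only [MM, map_sum, map_smul]
  rfl

lemma MM_aux (T : ℕ → ℕ → Conf V) (s q : ℕ) (h : s < q) :
    ∑ x ∈ Finset.HasAntidiagonal.antidiagonal s, (x.2.choose q : ℂ) • T x.1 x.2 = 0 := by
  apply Finset.sum_eq_zero
  rintro ⟨r, n⟩ hx
  have : n < q := by simp at hx; omega
  simp [Nat.choose_eq_zero_of_lt this]

lemma MM_sh1 (T : ℕ → ℕ → Conf V) (p q : ℕ) :
    MM (fun r n => sh (fun r => T r n) r) p q = sh (fun p => MM T p q) p := by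
  cases p with
  | zero =>
    apply Finset.sum_eq_zero
    rintro ⟨r, n⟩ hx
    cases r with
    | zero => simp [sh]
    | succ r =>
      have : n < q := by simp at hx; omega
      simp [Nat.choose_eq_zero_of_lt this]
  | succ p =>
    simp only [MM, sh]
    rw [show p + 1 + q = p + q + 1 by ring, Finset.Nat.antidiagonal_succ, Finset.sum_cons,
      Finset.sum_map]
    simp [sh]

lemma MM_sh2 (T : ℕ → ℕ → Conf V) (p q : ℕ) :
    MM (fun r n => sh (fun n => T r n) n) p q
      = sh (fun p => MM T p q) p + sh (fun q => MM T p q) q := by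
  have key : ∀ s q, ∑ x ∈ Finset.HasAntidiagonal.antidiagonal (s + 1), (x.2.choose q : ℂ) •
      sh (fun n => T x.1 n) x.2
      = ∑ x ∈ Finset.HasAntidiagonal.antidiagonal s, ((x.2 + 1).choose q : ℂ) • T x.1 x.2 := by
    intro s q
    rw [Finset.Nat.antidiagonal_succ', Finset.sum_cons, Finset.sum_map]
    simp [sh]
  cases q with
  | zero =>
    cases p with
    | zero => simp [MM, sh]
    | succ p =>
      simp only [MM, sh_z, sh_s]
      rw [show p + 1 + 0 = p + 0 + 1 by ring, key]
      simp
  | succ q =>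
    simp only [MM, sh_z, sh_s]
    rw [← add_assoc, key]
    simp only [Nat.choose_succ_succ, Nat.cast_add, add_smul, Finset.sum_add_distrib]
    rw [add_comm]
    congr 1
    cases p with
    | zero => rw [MM_aux _ _ _ (by omega)]; simp [sh]
    | succ p =>
      simp only [sh_s]
      rw [show p + 1 + q = p + (q + 1) by ring]

lemma lmul_sh (P : LP V) (n : ℕ) : lmul P n = sh P n := by
  cases n
  · exact lmul_z P
  · exact lmul_succ P _
lemma ldOp_sh (P : LP V) (n : ℕ) : ldOp P n = sh P n + Dop (P n) := by
  cases n
  · rw [ldOp_z]; simp [sh]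
  · rw [ldOp_succ]; rfl

lemma QDl (a b : Conf V) (n : ℕ) : Q B (Dop a) b n = - sh (Q B a b) n := by
  rw [Q_D_left, Finsupp.neg_apply, lmul_sh]
lemma QDr (a b : Conf V) (n : ℕ) : Q B a (Dop b) n = sh (Q B a b) n + Dop (Q B a b n) := by
  rw [Q_D_right, ldOp_sh]
lemma Qsh_r (a : Conf V) (f : ℕ → Conf V) (q p : ℕ) :
    Q B a (sh f q) p = sh (fun q => Q B a (f q) p) q := by
  cases q <;> simp [sh]
lemma Qsh_l (a : Conf V) (f : ℕ → Conf V) (q p : ℕ) :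
    Q B (sh f q) a p = sh (fun q => Q B (f q) a p) q := by
  cases q <;> simp [sh]

/-- Jacobi identity for three elements -/
def Jac (a b c : Conf V) : Prop := ∀ p q : ℕ, Q B a (Q B b c q) p =
  MM (fun r n => Q B (Q B a b r) c n) p q + Q B b (Q B a c p) q

lemma sh_congr {W : Type} [Zero W] {f g : ℕ → W} (n : ℕ) (h : ∀ n, f n = g n) :
    sh f n = sh g n := by rw [funext h]
lemma sh_add {W : Type} [AddCommGroup W] (f g : ℕ → W) (n : ℕ) :
    sh (fun n => f n + g n) n = sh f n + sh g n := by
  cases n <;> simp [sh]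
lemma sh_neg {W : Type} [AddCommGroup W] (f : ℕ → W) (n : ℕ) :
    sh (fun n => - f n) n = - sh f n := by
  cases n <;> simp [sh]

lemma Jac_Da {a b c : Conf V} (h : Jac B a b c) : Jac B (Dop a) b c := by
  intro p q
  simp only [QDl, map_neg, LinearMap.neg_apply, Finsupp.neg_apply, Qsh_l, Qsh_r, MM_neg]
  rw [MM_sh1 (fun r n => Q B (Q B a b r) c n),
    sh_congr p (g := fun p => MM (fun r n => Q B (Q B a b r) c n) p q + Q B b (Q B a c p) q)
      (fun p => h p q), sh_add]
  abel

lemma Jac_Db {a b c : Conf V} (h : Jac B a b c) : Jac B a (Dop b) c := by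
  intro p q
  simp only [QDl, QDr, map_neg, map_add, LinearMap.neg_apply, LinearMap.add_apply,
    Finsupp.add_apply, Finsupp.neg_apply, Qsh_l, Qsh_r, MM_neg, MM_add]
  have h1 := MM_sh2 (fun r n => Q B (Q B a b r) c n) p q
  rw [MM_sh1 (fun r n => Q B (Q B a b r) c n)]
  erw [h1]
  rw [sh_congr q (g := fun q => MM (fun r n => Q B (Q B a b r) c n) p q + Q B b (Q B a c p) q)
      (fun q => h p q), sh_add]
  abel

lemma Jac_Dc {a b c : Conf V} (h : Jac B a b c) : Jac B a b (Dop c) := by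
  intro p q
  simp only [QDr, map_add, LinearMap.add_apply,
    Finsupp.add_apply, Qsh_r, MM_add, MM_D]
  have h1 := MM_sh2 (fun r n => Q B (Q B a b r) c n) p q
  erw [h1]
  rw [sh_congr q (g := fun q => MM (fun r n => Q B (Q B a b r) c n) p q + Q B b (Q B a c p) q)
      (fun q => h p q), sh_add]
  have h2 : sh (Q B a (Q B b c q)) p = sh (fun p => MM (fun r n => Q B (Q B a b r) c n) p q
      + Q B b (Q B a c p) q) p := sh_congr p (fun p => h p q)
  rw [h2, sh_add, h p q, Dop_add]
  abel

lemma jacobi (S : Set V) (hS : Submodule.span ℂ S = ⊤)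
    (h : ∀ u ∈ S, ∀ v ∈ S, ∀ w ∈ S, Jac B (.single 0 u) (.single 0 v) (.single 0 w))
    (a b c : Conf V) : Jac B a b c := by
  induction a using conf_ind S hS with
  | h0 => intro p q; simp [MM]
  | hadd x y hx hy =>
    intro p q
    have h1 := hx p q
    have h2 := hy p q
    simp only [map_add, LinearMap.add_apply, Finsupp.add_apply, MM_add, h1, h2]; abel
  | hsm k x hx =>
    intro p q
    have h1 := hx p q
    simp only [map_smul, LinearMap.smul_apply, Finsupp.smul_apply, MM_smul, h1, smul_add]
  | hD x hx => exact Jac_Da B hx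
  | hs u hu =>
    induction b using conf_ind S hS with
    | h0 => intro p q; simp [MM]
    | hadd x y hx hy =>
      intro p q
      have h1 := hx p q
      have h2 := hy p q
      simp only [map_add, LinearMap.add_apply, Finsupp.add_apply, MM_add, h1, h2]; abel
    | hsm k x hx =>
      intro p q
      have h1 := hx p q
      simp only [map_smul, LinearMap.smul_apply, Finsupp.smul_apply, MM_smul, h1, smul_add]
    | hD x hx => exact Jac_Db B hx
    | hs v hv =>
      induction c using conf_ind S hS with
      | h0 => intro p q; simp [MM]
      | hadd x y hx hy =>
        intro p q
        have h1 := hx p q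
        have h2 := hy p q
        simp only [map_add, LinearMap.add_apply, Finsupp.add_apply, MM_add, h1, h2]; abel
      | hsm k x hx =>
        intro p q
        have h1 := hx p q
        simp only [map_smul, LinearMap.smul_apply, Finsupp.smul_apply, MM_smul, h1, smul_add]
      | hD x hx => exact Jac_Dc B hx
      | hs w hw => exact h u hu v hv w hw

lemma ldL_top (P : LP V) (hP : ∀ n > 1, P n = 0) (m : ℕ) :
    (∀ n > m + 1, (ldL V ^ m) P n = 0) ∧ (ldL V ^ m) P (m + 1) = P 1 := by
  induction m with
  | zero => simpa using hP
  | succ m ih =>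
    rw [pow_succ']
    have key : ∀ n, (ldL V * ldL V ^ m) P (n + 1) =
      (ldL V ^ m) P n + Dop ((ldL V ^ m) P (n + 1)) := fun n => ldOp_succ _ n
    refine ⟨?_, ?_⟩
    · intro n hn
      obtain ⟨n, rfl⟩ : ∃ k, n = k + 1 := ⟨n - 1, by omega⟩
      rw [key, ih.1 n (by omega), ih.1 (n + 1) (by omega), Dop_zero, add_zero]
    · rw [key, ih.2, ih.1 _ (by omega), Dop_zero, add_zero]

lemma Q_top (hB : ∀ u v, ∀ n > 1, B u v n = 0) (u : V) (x : Conf V) (d : ℕ)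
    (hx : ∀ n > d, x n = 0) : Q B (.single 0 u) x (d + 1) = B u (x d) 1 := by
  have h1 : x = ∑ m ∈ Finset.range (d + 1), Finsupp.single m (x m) := by
    ext n : 1
    simp only [Finsupp.finsetSum_apply]
    by_cases hn : n ≤ d
    · rw [Finset.sum_eq_single n]
      · simp
      · intro b _ hb; simp [Finsupp.single_apply, hb]
      · intro h; simp at h; omega
    · rw [hx n (by omega), Finset.sum_eq_zero]
      intro m hm
      simp at hm
      rw [Finsupp.single_apply, if_neg (by omega)]
  conv_lhs => rw [h1]
  rw [map_sum, Finsupp.finsetSum_apply, Finset.sum_range_succ, Finset.sum_eq_zero, zero_add,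
    Q_single]
  · simpa using (ldL_top _ (hB u (x d)) d).2
  · intro m hm
    simp at hm
    rw [Q_single]
    simpa using (ldL_top _ (hB u (x m)) m).1 (d + 1) (by omega)


/-- value of a bracket `[x_λ y] = (α∂ + β + γλ) z` -/
def Val (x y z : Conf V) (α β γ : ℂ) : Prop :=
  Q B x y = .single 0 (α • Dop z + β • z) + .single 1 (γ • z)

section
variable {B}
lemma Val.v0 {x y z : Conf V} {α β γ : ℂ} (h : Val B x y z α β γ) :
    Q B x y 0 = α • Dop z + β • z := by rw [h]; simp
lemma Val.v1 {x y z : Conf V} {α β γ : ℂ} (h : Val B x y z α β γ) :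
    Q B x y 1 = γ • z := by rw [h]; simp
lemma Val.v2 {x y z : Conf V} {α β γ : ℂ} (h : Val B x y z α β γ) (n : ℕ) (hn : 2 ≤ n) :
    Q B x y n = 0 := by
  rw [h, Finsupp.add_apply, Finsupp.single_apply, Finsupp.single_apply, if_neg (by omega),
    if_neg (by omega), add_zero]

lemma Val.r3 {x y z : Conf V} {α β γ : ℂ} (h : Val B x y z α β γ) (n : ℕ) (hn : 3 ≤ n) :
    Q B x (Dop y) n = 0 := by
  obtain ⟨n, rfl⟩ : ∃ k, n = k + 1 := ⟨n - 1, by omega⟩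
  rw [QDr]; simp only [sh]; rw [h.v2 _ (by omega), h.v2 _ (by omega), Dop_zero, add_zero]
lemma Val.l3 {x y z : Conf V} {α β γ : ℂ} (h : Val B x y z α β γ) (n : ℕ) (hn : 3 ≤ n) :
    Q B (Dop x) y n = 0 := by
  obtain ⟨n, rfl⟩ : ∃ k, n = k + 1 := ⟨n - 1, by omega⟩
  rw [QDl]; simp only [sh]; rw [h.v2 _ (by omega), neg_zero]

lemma van_r {e1 e2 e3 f g : Conf V} {α β γ α' β' γ' : ℂ} (h : Val B e2 e3 f α β γ)
    (h' : Val B e1 f g α' β' γ') (p q : ℕ) (hpq : 3 ≤ p + q) :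
    Q B e1 (Q B e2 e3 q) p = 0 := by
  rcases q with _ | _ | q
  · rw [h.v0]
    simp [h'.r3 p (by omega), h'.v2 p (by omega)]
  · rw [zero_add, h.v1]
    simp [h'.v2 p (by omega)]
  · rw [h.v2 _ (by omega)]; simp
lemma van_l {e1 e2 e3 f g : Conf V} {α β γ α' β' γ' : ℂ} (h : Val B e1 e2 f α β γ)
    (h' : Val B f e3 g α' β' γ') (p q : ℕ) (hpq : 3 ≤ p + q) :
    Q B (Q B e1 e2 q) e3 p = 0 := by
  rcases q with _ | _ | q
  · rw [h.v0]
    simp [h'.l3 p (by omega), h'.v2 p (by omega)]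
  · rw [zero_add, h.v1]
    simp [h'.v2 p (by omega)]
  · rw [h.v2 _ (by omega)]; simp
end

end gen
end QLCA

open QLCA

namespace CL1

/-- index type -/
abbrev Ix := {i : ℤ // (-1 : ℤ) ≤ i}
/-- the space spanned by the generators -/
abbrev VV := Ix →₀ ℂ

/-- bracket of generators -/
noncomputable def bb (c : ℂ) (i j : Ix) : LP VV :=
    (Finsupp.single 0
        (Finsupp.single 1 (((i.1 : ℂ) + 1) • sL (i.1 + j.1))
          + Finsupp.single 0 ((c * ((j.1 : ℂ) - (i.1 : ℂ))) • sL (i.1 + j.1)))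
      + Finsupp.single 1
          (Finsupp.single 0 (((i.1 : ℂ) + (j.1 : ℂ) + 2) • sL (i.1 + j.1))))

lemma B1_eq (c : ℂ) (u v : VV) : B1 c u v =
    u.sum fun i ui => v.sum fun j vj => (ui * vj) • bb c i j := rfl

/-- `B1` as a bilinear map -/
noncomputable def BL (c : ℂ) : VV →ₗ[ℂ] VV →ₗ[ℂ] LP VV :=
  LinearMap.mk₂ ℂ (B1 c)
    (by
      intro a b d
      simp only [B1_eq]
      apply Finsupp.sum_add_index' <;> simp [Finsupp.sum_add, add_mul, add_smul])
    (by
      intro k a b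
      simp only [B1_eq]
      rw [Finsupp.sum_smul_index']
      · rw [Finsupp.smul_sum]
        simp only [Finsupp.smul_sum, smul_eq_mul, mul_assoc, mul_smul]
      · simp)
    (by
      intro a b d
      simp only [B1_eq]
      rw [← Finsupp.sum_add]
      congr 1; ext1 m; ext1 am
      apply Finsupp.sum_add_index' <;> simp [mul_add, add_smul])
    (by
      intro k a b
      simp only [B1_eq]
      rw [Finsupp.smul_sum]
      congr 1; ext1 m; ext1 am
      rw [Finsupp.sum_smul_index', Finsupp.smul_sum]
      · simp only [smul_eq_mul, mul_left_comm _ k, mul_smul k]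
      · simp)

lemma qbr_Q (c : ℂ) (a b : Conf VV) : qbr (B1 c) a b = Q (BL c) a b := rfl

lemma BL_single (c : ℂ) (i j : Ix) (x y : ℂ) :
    BL c (.single i x) (.single j y) = (x * y) • bb c i j := by
  change B1 c _ _ = _
  rw [B1_eq, Finsupp.sum_single_index, Finsupp.sum_single_index]
  · simp
  · simp

/-- generators -/
noncomputable def G (i : ℤ) : Conf VV := .single 0 (sL i)

lemma sL_of (i : Ix) : sL i.1 = .single i 1 := by
  simp [sL, i.2]

lemma G_lt (i : ℤ) (h : ¬ -1 ≤ i) : G i = 0 := by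
  simp [G, sL, h]

lemma Val_G (c : ℂ) (i j : ℤ) (hi : -1 ≤ i) (hj : -1 ≤ j) :
    Val (BL c) (G i) (G j) (G (i + j)) (i + 1) (c * (j - i)) (i + j + 2) := by
  have h := BL_single c ⟨i, hi⟩ ⟨j, hj⟩ 1 1
  rw [← sL_of, ← sL_of] at h
  rw [Val, G, G, Q_single]
  simp only at h
  rw [h]
  simp [bb, G, Dop_single]

lemma Val_G' (c : ℂ) (i j k : ℤ) (hi : -1 ≤ i) (hj : -1 ≤ j) (hk : -1 ≤ k) :
    ∃ g, Val (BL c) (G (i + j)) (G k) g ((i + j : ℤ) + 1) (c * (k - (i + j : ℤ)))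
      ((i + j : ℤ) + k + 2) ∧ (g = G (i + j + k) ∨ i = -1 ∧ j = -1) := by
  by_cases h : -1 ≤ i + j
  · exact ⟨_, Val_G c _ _ h hk, Or.inl rfl⟩
  · refine ⟨0, ?_, Or.inr (by omega)⟩
    rw [G_lt _ h, Val]
    simp [Dop_zero]

lemma Val_G'' (c : ℂ) (i j k : ℤ) (hi : -1 ≤ i) (hj : -1 ≤ j) (hk : -1 ≤ k) :
    ∃ g, Val (BL c) (G k) (G (i + j)) g (k + 1) (c * ((i + j : ℤ) - k))
      (k + (i + j : ℤ) + 2) ∧ (g = G (k + (i + j)) ∨ i = -1 ∧ j = -1) := by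
  by_cases h : -1 ≤ i + j
  · exact ⟨_, Val_G c _ _ hk h, Or.inl rfl⟩
  · refine ⟨0, ?_, Or.inr (by omega)⟩
    rw [G_lt _ h, Val]
    simp [Dop_zero]

lemma jac_G (c : ℂ) (i j k : ℤ) (hi : -1 ≤ i) (hj : -1 ≤ j) (hk : -1 ≤ k) :
    Jac (BL c) (G i) (G j) (G k) := by
  have v12 := Val_G c i j hi hj
  have v23 := Val_G c j k hj hk
  have v13 := Val_G c i k hi hk
  obtain ⟨g3, w3, h3⟩ := Val_G' c i j k hi hj hk
  obtain ⟨g1, w1, h1⟩ := Val_G'' c j k i hj hk hi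
  obtain ⟨g2, w2, h2⟩ := Val_G'' c i k j hi hk hj
  rw [show i + (j + k) = i + j + k by ring] at h1
  rw [show j + (i + k) = i + j + k by ring] at h2
  generalize G (i + j + k) = g at h1 h2 h3
  intro p q
  by_cases hpq : 3 ≤ p + q
  · rw [van_r v23 w1 p q hpq, van_r v13 w2 q p (by omega), MM, Finset.sum_eq_zero, add_zero]
    rintro ⟨r, n⟩ hx
    have hx : r + n = p + q := by simpa using hx
    rw [van_l v12 w3 n r (by omega), smul_zero]
  · have : (p = 0 ∧ q = 0) ∨ (p = 1 ∧ q = 0) ∨ (p = 0 ∧ q = 1) ∨ (p = 2 ∧ q = 0) ∨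
      (p = 1 ∧ q = 1) ∨ (p = 0 ∧ q = 2) := by omega
    have e12 := v12.v2 2 le_rfl
    have e23 := v23.v2 2 le_rfl
    have e13 := v13.v2 2 le_rfl
    have d3 := w3.v2 2 le_rfl
    have d1 := w1.v2 2 le_rfl
    have d2 := w2.v2 2 le_rfl
    rcases this with ⟨rfl, rfl⟩ | ⟨rfl, rfl⟩ | ⟨rfl, rfl⟩ | ⟨rfl, rfl⟩ | ⟨rfl, rfl⟩ | ⟨rfl, rfl⟩ <;>
    simp [MM, Finset.Nat.antidiagonal_succ, v12.v0, v12.v1, v23.v0, v23.v1, v13.v0, v13.v1,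
      w1.v0, w1.v1, w2.v0, w2.v1, w3.v0, w3.v1, e12, e23, e13, d1, d2, d3, QDl, QDr, sh,
      Dop_add, Dop_smul, Dop_zero, -smul_eq_zero] <;>
    rcases h1 with rfl | ⟨rfl, rfl⟩ <;> rcases h2 with rfl | ⟨h2, h2'⟩ <;>
    rcases h3 with rfl | ⟨h3, h3'⟩ <;> subst_vars <;> push_cast <;> module

lemma span_G : Submodule.span ℂ {v : VV | ∃ i : ℤ, -1 ≤ i ∧ v = sL i} = ⊤ := by
  rw [eq_top_iff]
  rintro v -
  induction v using Finsupp.induction_linear with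
  | zero => exact zero_mem _
  | add f g hf hg => exact add_mem hf hg
  | single i x =>
    have : Finsupp.single i x = x • sL i.1 := by rw [sL_of]; simp
    rw [this]
    exact Submodule.smul_mem _ _ (Submodule.subset_span ⟨i.1, i.2, rfl⟩)

lemma skew_G (c : ℂ) (i j : ℤ) (hi : -1 ≤ i) (hj : -1 ≤ j) :
    Q (BL c) (G i) (G j) = - NL (Q (BL c) (G j) (G i)) := by
  have h1 := Val_G c i j hi hj
  have h2 := Val_G c j i hj hi
  rw [add_comm j i] at h2
  rw [Val] at h1 h2
  rw [h1, h2, map_add, NL_single, NL_single]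
  simp only [pow_one, ldL_single]
  simp only [pow_zero, one_smul, Module.End.one_apply, Dop_smul, ← Finsupp.smul_single,
    Finsupp.single_add]
  push_cast
  module

lemma isLie (c : ℂ) : IsLieConf (B1 c) := by
  refine ⟨?_, ?_, ?_, ?_, ?_, ?_, ?_, ?_⟩ <;> simp only [qbr_Q]
  · intro a b d; simp
  · intro a b d; simp
  · intro a b d; simp
  · intro a b d; simp
  · exact Q_D_left _
  · exact Q_D_right _
  · apply skew _ _ span_G
    rintro _ ⟨i, hi, rfl⟩ _ ⟨j, hj, rfl⟩
    exact skew_G c i j hi hj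
  · intro a b d p q
    rw [MM_eq (fun r n => Q (BL c) (Q (BL c) a b r) d n)]
    refine jacobi (BL c) _ span_G ?_ a b d p q
    rintro _ ⟨i, hi, rfl⟩ _ ⟨j, hj, rfl⟩ _ ⟨k, hk, rfl⟩
    exact jac_G c i j k hi hj hk

lemma BL_van (c : ℂ) (u v : VV) (n : ℕ) (hn : n > 1) : BL c u v n = 0 := by
  induction u using Finsupp.induction_linear with
  | zero => simp
  | add f g hf hg => simp [hf, hg]
  | single i x =>
    induction v using Finsupp.induction_linear with
    | zero => simp
    | add f g hf hg => simp [hf, hg]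
    | single j y =>
      rw [BL_single, bb, Finsupp.smul_apply, Finsupp.add_apply, Finsupp.single_apply,
        Finsupp.single_apply, if_neg (by omega), if_neg (by omega)]
      simp

/-- the operator `L_j ↦ (i+j+2) L_{i+j}` -/
noncomputable def Lam (i : ℤ) : VV →ₗ[ℂ] VV :=
  Finsupp.linearCombination ℂ (fun j : Ix => ((i : ℂ) + j.1 + 2) • sL (i + j.1))

lemma BL_one (c : ℂ) (i : ℤ) (hi : -1 ≤ i) (v : VV) : BL c (sL i) v 1 = .single 0 (Lam i v) := by
  induction v using Finsupp.induction_linear with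
  | zero => simp
  | add f g hf hg => simp [hf, hg]
  | single j y =>
    rw [show sL i = .single (⟨i, hi⟩ : Ix) 1 from sL_of ⟨i, hi⟩, BL_single]
    simp [bb, Lam]

lemma sL_apply (i : ℤ) (j : Ix) : sL i j = if i = j.1 then 1 else 0 := by
  by_cases h : -1 ≤ i
  · rw [show sL i = .single (⟨i, h⟩ : Ix) 1 from sL_of ⟨i, h⟩, Finsupp.single_apply]
    simp [Subtype.ext_iff]
  · have : i ≠ j.1 := by have := j.2; omega
    simp [sL, h, this]

lemma Lam_zero (v : VV) (j : Ix) : Lam 0 v j = ((j.1 : ℂ) + 2) * v j := by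
  induction v using Finsupp.induction_linear with
  | zero => simp
  | add f g hf hg => simp [hf, hg, mul_add]
  | single k y =>
    simp only [Lam, Finsupp.linearCombination_single, Finsupp.smul_apply, sL_apply,
      Finsupp.single_apply, Subtype.ext_iff]
    split_ifs with h1 h2 h2
    · simp [h2]; ring
    · omega
    · omega
    · simp

lemma Lam_neg (v : VV) (j : Ix) :
    Lam (-1) v j = ((j.1 : ℂ) + 2) * v ⟨j.1 + 1, by have := j.2; omega⟩ := by
  induction v using Finsupp.induction_linear with
  | zero => simp
  | add f g hf hg => simp [hf, hg, mul_add]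
  | single k y =>
    simp only [Lam, Finsupp.linearCombination_single, Finsupp.smul_apply, sL_apply,
      Finsupp.single_apply, Subtype.ext_iff]
    split_ifs with h1 h2 h2
    · simp [h2]; ring
    · omega
    · omega
    · simp

lemma cast_ne (j : Ix) : (j.1 : ℂ) + 2 ≠ 0 := by
  have := j.2
  have h : j.1 + 2 ≠ 0 := by omega
  exact_mod_cast h

lemma desc0 (c : ℂ) (I : Submodule ℂ (Conf VV)) (w : VV) (hw : w ≠ 0)
    (hI : Finsupp.single 0 w ∈ I) (h : ∀ j : Ix, 0 ≤ j.1 → w j = 0) : G (-1) ∈ I := by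
  have e : w = w ⟨-1, le_rfl⟩ • sL (-1) := by
    ext j
    rw [Finsupp.smul_apply, sL_apply]
    have := j.2
    by_cases hj : -1 = j.1
    · have : j = ⟨-1, le_rfl⟩ := Subtype.ext hj.symm
      subst this; simp
    · rw [if_neg hj, h j (by omega)]; simp
  have hne : w ⟨-1, le_rfl⟩ ≠ 0 := by
    intro h0
    rw [h0, zero_smul] at e
    exact hw e
  rw [e, ← Finsupp.smul_single] at hI
  exact (Submodule.smul_mem_iff I hne).1 hI

lemma desc (c : ℂ) (I : Submodule ℂ (Conf VV))
    (hLam : ∀ i : ℤ, -1 ≤ i → ∀ w : VV, Finsupp.single 0 w ∈ I → Finsupp.single 0 (Lam i w) ∈ I)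
    (N : ℕ) : ∀ w : VV, w ≠ 0 → Finsupp.single 0 w ∈ I → (∀ j : Ix, (N : ℤ) ≤ j.1 → w j = 0) →
      G (-1) ∈ I := by
  induction N with
  | zero =>
    intro w hw hI h
    exact desc0 c I w hw hI (by simpa using h)
  | succ N ih =>
    intro w hw hI h
    by_cases h0 : Lam (-1) w = 0
    · apply desc0 c I w hw hI
      intro j hj
      have h1 := Lam_neg w ⟨j.1 - 1, by omega⟩
      rw [h0] at h1
      have h2 := cast_ne ⟨j.1 - 1, by omega⟩
      have h3 : (⟨j.1 - 1 + 1, by omega⟩ : Ix) = j := Subtype.ext (by simp)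
      simp only [h3, Finsupp.zero_apply] at h1
      exact (mul_eq_zero.1 h1.symm).resolve_left h2
    · apply ih _ h0 (hLam _ le_rfl _ hI)
      intro j hj
      rw [Lam_neg, h _ (by push_cast; simp; omega), mul_zero]

lemma simple (c : ℂ) : ConfSimple (B1 c) := by
  constructor
  · refine ⟨G 0, G 0, ?_⟩
    rw [qbr_Q]
    intro h
    have h1 := (Val_G c 0 0 (by norm_num) (by norm_num)).v1
    rw [h] at h1
    have h2 := congrArg (fun x : Conf VV => x 0 ⟨0, by norm_num⟩) h1
    simp [G, sL_apply] at h2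
  · rintro I ⟨hD, hI⟩
    by_cases hbot : I = ⊥
    · exact Or.inl hbot
    right
    obtain ⟨x, hx, hx0⟩ := Submodule.exists_mem_ne_zero_of_ne_bot hbot
    have hLam : ∀ i : ℤ, -1 ≤ i → ∀ w : VV, Finsupp.single 0 w ∈ I →
        Finsupp.single 0 (Lam i w) ∈ I := by
      intro i hi w hw
      have h1 := hI (.single 0 (sL i)) _ hw 1
      rw [qbr_Q, Q_top _ (BL_van c) (sL i) (.single 0 w) 0
        (fun n hn => Finsupp.single_eq_of_ne (by omega)), BL_one c i hi] at h1
      simpa using h1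
    have hne : x.support.Nonempty := Finsupp.support_nonempty_iff.2 hx0
    set d := x.support.max' hne with hd
    have hxd : x d ≠ 0 := Finsupp.mem_support_iff.1 (Finset.max'_mem _ hne)
    have hgt : ∀ n > d, x n = 0 := by
      intro n hn
      by_contra h
      have := Finset.le_max' x.support n (Finsupp.mem_support_iff.2 h)
      omega
    have h1 := hI (.single 0 (sL 0)) x hx (d + 1)
    rw [qbr_Q, Q_top _ (BL_van c) (sL 0) x d hgt, BL_one c 0 (by norm_num)] at h1
    have hw0 : Lam 0 (x d) ≠ 0 := by
      intro h
      apply hxd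
      ext j
      have h2 := Lam_zero (x d) j
      rw [h] at h2
      exact (mul_eq_zero.1 h2.symm).resolve_left (cast_ne j)
    have hG : G (-1) ∈ I := by
      generalize Lam 0 (x d) = w at h1 hw0
      refine desc c I hLam (w.support.sup (fun j => j.1.toNat + 1)) w hw0 h1 ?_
      intro j hj
      by_contra hne
      have := Finset.le_sup (f := fun j : Ix => j.1.toNat + 1) (Finsupp.mem_support_iff.2 hne)
      omega
    have hall : ∀ j : ℤ, -1 ≤ j → G j ∈ I := by
      intro j hj
      have h2 := hLam (j + 1) (by omega) _ hG
      rw [show sL (-1) = .single (⟨-1, le_rfl⟩ : Ix) 1 from sL_of ⟨-1, le_rfl⟩] at h2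
      simp only [Lam, Finsupp.linearCombination_single, one_smul, ← Finsupp.smul_single] at h2
      have h3 : (((j + 1 : ℤ) : ℂ) + ((-1 : ℤ) : ℂ) + 2) ≠ 0 := by
        have : j + 1 + -1 + 2 ≠ 0 := by omega
        exact_mod_cast this
      have h4 := (Submodule.smul_mem_iff I h3).1 h2
      simpa [G] using h4
    rw [eq_top_iff]
    rintro a -
    induction a using conf_ind _ span_G with
    | h0 => exact zero_mem _
    | hadd a b ha hb => exact add_mem ha hb
    | hsm k a ha => exact Submodule.smul_mem _ _ ha
    | hD a ha => exact hD a ha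
    | hs v hv =>
      obtain ⟨i, hi, rfl⟩ := hv
      exact hall i hi

end CL1

/-- for every `c ∈ ℂ`, `CL₁(c)` is a simple Lie conformal
algebra. -/
theorem stmt_12 (c : ℂ) : IsLieConf (B1 c) ∧ ConfSimple (B1 c) := by
  exact ⟨CL1.isLie c, CL1.simple c⟩
end

section
/- Let Δ be an additive subgroup of ℂ and b ∈ ℂ with b ∉ Δ. Let [·,·] be any Lie bracket on A_2 such that (A_2,∘,[·,·]) is a Gel'fand-Dorfman bialgebra. Then there exists an additive group homomorphism φ : Δ → ℂ such that [x_α, x_β] = (1/b)(φ(β)α − φ(α)β + b(φ(β) − φ(α))) x_{α+β} for all α,β ∈ Δ. -/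
set_option maxSynthPendingDepth 3

open QLCA

/-- The Novikov product of `A₂`: `x_α ∘ x_β = (β+b) x_{α+β}`, extended
bilinearly. -/
noncomputable def A2mul (Δ : AddSubgroup ℂ) (b : ℂ) (u v : Δ →₀ ℂ) : Δ →₀ ℂ :=
  Finsupp.sum u fun α uα => Finsupp.sum v fun β vβ =>
    (uα * vβ * ((β : ℂ) + b)) • Finsupp.single (α + β) (1 : ℂ)


lemma A2mul_ss (Δ : AddSubgroup ℂ) (b : ℂ) (α β : Δ) :
    A2mul Δ b (Finsupp.single α 1) (Finsupp.single β 1)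
      = ((β : ℂ) + b) • Finsupp.single (α + β) (1 : ℂ) := by
  simp [A2mul, -Finsupp.single_mul, -Finsupp.single_add]

lemma A2mul_right (Δ : AddSubgroup ℂ) (b : ℂ) (v : Δ →₀ ℂ) (γ δ : Δ) :
    A2mul Δ b v (Finsupp.single γ 1) (δ + γ) = ((γ : ℂ) + b) * v δ := by
  classical
  have h : A2mul Δ b v (Finsupp.single γ 1)
      = v.sum fun α u => Finsupp.single (α + γ) (u * ((γ : ℂ) + b)) := by
    simp [A2mul, -Finsupp.single_mul, -Finsupp.single_add]
  rw [h, Finsupp.sum_apply, Finsupp.sum]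
  simp only [Finsupp.single_apply, add_left_inj]
  rw [Finset.sum_ite_eq']
  split_ifs with h1
  · ring
  · simp [Finsupp.notMem_support_iff.mp h1]

lemma A2mul_left (Δ : AddSubgroup ℂ) (b : ℂ) (v : Δ →₀ ℂ) (α δ : Δ) :
    A2mul Δ b (Finsupp.single α 1) v (α + δ) = ((δ : ℂ) + b) * v δ := by
  classical
  have h : A2mul Δ b (Finsupp.single α 1) v
      = v.sum fun β u => Finsupp.single (α + β) (u * ((β : ℂ) + b)) := by
    simp [A2mul, -Finsupp.single_mul, -Finsupp.single_add]
  rw [h, Finsupp.sum_apply, Finsupp.sum]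
  simp only [Finsupp.single_apply, add_right_inj]
  rw [Finset.sum_ite_eq']
  split_ifs with h1
  · ring
  · simp [Finsupp.notMem_support_iff.mp h1]

lemma A2_key (Δ : AddSubgroup ℂ) (b : ℂ)
    (lie : (Δ →₀ ℂ) → (Δ →₀ ℂ) → (Δ →₀ ℂ)) (hGD : IsGD (A2mul Δ b) lie)
    (F : Δ → Δ → Δ → ℂ)
    (hF : ∀ θ α β, F θ α β = lie (Finsupp.single α 1) (Finsupp.single β 1) (α + β + θ))
    (θ α β γ : Δ) :
    ((β : ℂ) + b) * F θ (α + β) γ - ((γ : ℂ) + b) * F θ (α + γ) β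
      + ((γ : ℂ) + b) * F θ α β - ((β : ℂ) + b) * F θ α γ
      - ((β : ℂ) + γ + θ + b) * F θ β γ = 0 := by
  obtain ⟨-, ⟨⟨-, -, hs, -⟩, -, -⟩, hc⟩ := hGD
  have h := hc (Finsupp.single α 1) (Finsupp.single β 1) (Finsupp.single γ 1)
  rw [A2mul_ss, A2mul_ss, hs, hs] at h
  have h2 := DFunLike.congr_fun h (α + β + γ + θ)
  simp only [Finsupp.sub_apply, Finsupp.add_apply, Finsupp.smul_apply, smul_eq_mul,
    Finsupp.zero_apply] at h2
  have e1 := A2mul_right Δ b (lie (Finsupp.single α 1) (Finsupp.single β 1)) γ (α + β + θ)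
  have e2 := A2mul_right Δ b (lie (Finsupp.single α 1) (Finsupp.single γ 1)) β (α + γ + θ)
  have e3 := A2mul_left Δ b (lie (Finsupp.single β 1) (Finsupp.single γ 1)) α (β + γ + θ)
  rw [show α + β + θ + γ = α + β + γ + θ by abel] at e1
  rw [show α + γ + θ + β = α + β + γ + θ by abel] at e2
  rw [show α + (β + γ + θ) = α + β + γ + θ by abel] at e3
  rw [e1, e2, e3] at h2
  simp only [hF]
  rw [show α + γ + β + θ = α + β + γ + θ by abel]
  push_cast at h2
  exact h2

theorem stmt_14 (Δ : AddSubgroup ℂ) (b : ℂ) (hb : b ∉ Δ)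
    (lie : (Δ →₀ ℂ) → (Δ →₀ ℂ) → (Δ →₀ ℂ)) (hGD : IsGD (A2mul Δ b) lie) :
    ∃ φ : Δ →+ ℂ, ∀ α β : Δ,
      lie (Finsupp.single α 1) (Finsupp.single β 1)
        = ((1 / b) * (φ β * (α : ℂ) - φ α * (β : ℂ) + b * (φ β - φ α)))
            • Finsupp.single (α + β) (1 : ℂ) := by
  have hskew : ∀ u v, lie u v = - lie v u := hGD.2.1.2.1
  obtain ⟨F, hF⟩ : ∃ F : Δ → Δ → Δ → ℂ, ∀ θ α β,
      F θ α β = lie (Finsupp.single α 1) (Finsupp.single β 1) (α + β + θ) :=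
    ⟨_, fun _ _ _ => rfl⟩
  have key := A2_key Δ b lie hGD F hF
  have hb0 : b ≠ 0 := fun h => hb (h ▸ Δ.zero_mem)
  have hnb : ∀ β : Δ, (β : ℂ) + b ≠ 0 := fun β h => hb (by
    have : b = -(β : ℂ) := by linear_combination h
    rw [this]; exact Δ.neg_mem β.2)
  have skew : ∀ θ α β, F θ α β = - F θ β α := by
    intro θ α β
    rw [hF, hF, hskew, Finsupp.neg_apply, add_comm α β]
  have g0 : ∀ θ, F θ 0 0 = 0 := by
    intro θ
    have := skew θ 0 0
    linear_combination this / 2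
  have h1 : ∀ θ β γ : Δ, (b - θ) * F θ β γ
      = ((β : ℂ) + b) * F θ 0 γ - ((γ : ℂ) + b) * F θ 0 β := by
    intro θ β γ
    have h := key θ 0 β γ
    rw [zero_add, zero_add, skew θ γ β] at h
    linear_combination h
  have hz : ∀ θ : Δ, θ ≠ 0 → ∀ β γ, F θ β γ = 0 := by
    intro θ hθ
    have hθ' : (θ : ℂ) ≠ 0 := by simpa using hθ
    have hg : ∀ γ, F θ 0 γ = 0 := by
      intro γ
      have h := h1 θ 0 γ
      rw [g0] at h
      push_cast at h
      have : (θ : ℂ) * F θ 0 γ = 0 := by linear_combination -h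
      exact (mul_eq_zero.mp this).resolve_left hθ'
    intro β γ
    have h := h1 θ β γ
    rw [hg, hg] at h
    have h3 : b - (θ : ℂ) ≠ 0 := by
      intro h4
      apply hb
      rw [sub_eq_zero.mp h4]; exact θ.2
    have : (b - (θ : ℂ)) * F θ β γ = 0 := by linear_combination h
    exact (mul_eq_zero.mp this).resolve_left h3
  have h2 : ∀ β γ : Δ, F 0 β γ
      = (1 / b) * (((β : ℂ) + b) * F 0 0 γ - ((γ : ℂ) + b) * F 0 0 β) := by
    intro β γ
    have h := h1 0 β γ
    push_cast at h
    field_simp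
    linear_combination h
  have hadd : ∀ α γ : Δ, F 0 0 (α + γ) = F 0 0 α + F 0 0 γ := by
    intro α γ
    have h := key 0 α 0 γ
    have e1 := h1 0 (α + 0) γ
    have e2 := h1 0 (α + γ) 0
    have e3 := h1 0 α 0
    have e4 := h1 0 α γ
    rw [g0] at e2 e3
    rw [add_zero] at h e1
    push_cast at h e1 e2 e3 e4
    have h5 : b * (((γ : ℂ) + b) * (F 0 0 (α + γ) - F 0 0 α - F 0 0 γ)) = 0 := by
      linear_combination b * h + ((γ : ℂ) + b) * e2 - ((γ : ℂ) + b) * e3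
    have := (mul_eq_zero.mp ((mul_eq_zero.mp h5).resolve_left hb0)).resolve_left (hnb γ)
    linear_combination this
  refine ⟨⟨⟨fun γ => F 0 0 γ, g0 0⟩, hadd⟩, fun α β => ?_⟩
  ext δ
  obtain ⟨θ, rfl⟩ : ∃ θ, δ = α + β + θ := ⟨δ - (α + β), by abel⟩
  rw [← hF]
  by_cases hθ : θ = 0
  · subst hθ
    rw [h2]
    simp
    left
    ring
  · rw [hz θ hθ]
    simp [hθ]
end

section
/- Let Δ be an additive subgroup of ℂ, b ∈ ℂ with 2b ∉ Δ, and φ : Δ → ℂ an additive group homomorphism. Then the free ℂ[∂]-module CL_2(b,φ) = ⊕_{α ∈ Δ} ℂ[∂]x_α with λ-bracket [x_α λ x_β] = ((α+b)∂ + (α+β+2b)λ) x_{α+β} + (1/b)(φ(α)β − φ(β)α + b(φ(α) − φ(β))) x_{α+β}, extended by conformal sesquilinearity, is a simple Lie conformal algebra. -/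
set_option maxSynthPendingDepth 3

open QLCA

/-- Generator values of the `λ`-bracket of `CL₂(b,φ)`:
`[x_α λ x_β] = ((α+b)∂ + (α+β+2b)λ) x_{α+β}
  + (1/b)(φ(α)β − φ(β)α + b(φ(α) − φ(β))) x_{α+β}`, extended bilinearly. -/
noncomputable def B2 (Δ : AddSubgroup ℂ) (b : ℂ) (φ : Δ →+ ℂ)
    (u v : Δ →₀ ℂ) : ℕ →₀ (ℕ →₀ (Δ →₀ ℂ)) :=
  Finsupp.sum u fun α uα => Finsupp.sum v fun β vβ => (uα * vβ) •
    (Finsupp.single 0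
        (Finsupp.single 1 (((α : ℂ) + b) • Finsupp.single (α + β) (1 : ℂ))
          + Finsupp.single 0
              (((1 / b) * (φ α * (β : ℂ) - φ β * (α : ℂ) + b * (φ α - φ β)))
                • Finsupp.single (α + β) (1 : ℂ)))
      + Finsupp.single 1
          (Finsupp.single 0
            (((α : ℂ) + (β : ℂ) + 2 * b) • Finsupp.single (α + β) (1 : ℂ))))

namespace CL2

variable {V : Type} [AddCommGroup V] [Module ℂ V]

/-- Multiplication by `∂` as a linear map. -/
noncomputable def DL : Conf V →ₗ[ℂ] Conf V := Finsupp.lmapDomain V ℂ (· + 1)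

/-- Multiplication by `λ` as a linear map. -/
noncomputable def lL : LP V →ₗ[ℂ] LP V := Finsupp.lmapDomain (ℕ →₀ V) ℂ (· + 1)

/-- Multiplication by `∂` on `λ`-polynomials as a linear map. -/
noncomputable def dL : LP V →ₗ[ℂ] LP V := Finsupp.mapRange.linearMap DL

/-- Multiplication by `λ+∂` as a linear map. -/
noncomputable def ldL : LP V →ₗ[ℂ] LP V := lL + dL

lemma Dop_eq (a : Conf V) : Dop a = DL a := rfl
lemma lmul_eq : (lmul : LP V → LP V) = lL := rfl
lemma dmul_eq (a : LP V) : dmul a = dL a := rfl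
lemma ldOp_eq : (ldOp : LP V → LP V) = ldL := rfl

lemma DL_single (n : ℕ) (v : V) : DL (Finsupp.single n v) = Finsupp.single (n + 1) v := by
  simp [DL]

lemma lL_single (n : ℕ) (v : Conf V) : lL (Finsupp.single n v) = Finsupp.single (n + 1) v := by
  simp [lL]

lemma dL_single (n : ℕ) (v : Conf V) : dL (Finsupp.single n v) = Finsupp.single n (DL v) := by
  simp [dL]

lemma lL_zero_apply (P : LP V) : lL P 0 = 0 := by
  simp only [lL, Finsupp.lmapDomain_apply]
  exact Finsupp.mapDomain_of_notMem_range _ _ (by simp)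

lemma lL_succ_apply (P : LP V) (n : ℕ) : lL P (n + 1) = P n := by
  simp only [lL, Finsupp.lmapDomain_apply]
  exact Finsupp.mapDomain_apply (f := (· + 1)) (add_left_injective 1) P n

lemma dL_apply (P : LP V) (n : ℕ) : dL P n = DL (P n) := by
  simp [dL]

lemma ldL_succ_apply (P : LP V) (n : ℕ) : ldL P (n + 1) = P n + DL (P (n + 1)) := by
  simp [ldL, lL_succ_apply, dL_apply]

lemma comm_ld : Commute (lL : LP V →ₗ[ℂ] LP V) ldL := by
  have h : Commute (lL : LP V →ₗ[ℂ] LP V) dL := by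
    refine Finsupp.lhom_ext fun n v => ?_
    simp [Module.End.mul_apply, lL_single, dL_single]
  exact (Commute.refl _).add_right h

lemma comm_dld : Commute (dL : LP V →ₗ[ℂ] LP V) ldL := by
  have h : Commute (lL : LP V →ₗ[ℂ] LP V) dL := by
    refine Finsupp.lhom_ext fun n v => ?_
    simp [Module.End.mul_apply, lL_single, dL_single]
  exact h.symm.add_right (Commute.refl _)

/-- The `λ`-bracket as a bilinear map. -/
noncomputable def qL (B : V →ₗ[ℂ] V →ₗ[ℂ] LP V) : Conf V →ₗ[ℂ] Conf V →ₗ[ℂ] LP V :=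
  Finsupp.lsum ℂ fun m => LinearMap.flip (Finsupp.lsum ℂ fun n =>
    (B.compr₂ (((-1 : ℂ) ^ m) • (lL ^ m * ldL ^ n))).flip)

lemma qL_single (B : V →ₗ[ℂ] V →ₗ[ℂ] LP V) (m n : ℕ) (u v : V) :
    qL B (Finsupp.single m u) (Finsupp.single n v) =
      ((-1 : ℂ) ^ m) • (lL ^ m) ((ldL ^ n) (B u v)) := by
  simp [qL]

lemma qbr_eq (B : V →ₗ[ℂ] V →ₗ[ℂ] LP V) (a b : Conf V) :
    qbr (fun u v => B u v) a b = qL B a b := by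
  rw [← Finsupp.sum_single a, ← Finsupp.sum_single b]
  simp only [Finsupp.sum_single]
  conv_rhs => rw [← Finsupp.sum_single a, ← Finsupp.sum_single b]
  simp only [Finsupp.sum, map_sum, LinearMap.sum_apply, qL_single, qbr, lmul_eq, ldOp_eq,
    Module.End.pow_apply]
  exact Finset.sum_comm

lemma qL_D_left (B : V →ₗ[ℂ] V →ₗ[ℂ] LP V) (a b : Conf V) :
    qL B (DL a) b = - lL (qL B a b) := by
  induction a using Finsupp.induction_linear with
  | zero => simp
  | add f g hf hg => simp only [map_add, LinearMap.add_apply, hf, hg]; abel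
  | single m u =>
    induction b using Finsupp.induction_linear with
    | zero => simp
    | add f g hf hg => simp only [map_add, hf, hg]; abel
    | single n v =>
      rw [DL_single, qL_single, qL_single, pow_succ' lL, Module.End.mul_apply, map_smul, pow_succ]
      module

lemma qL_D_right (B : V →ₗ[ℂ] V →ₗ[ℂ] LP V) (a b : Conf V) :
    qL B a (DL b) = ldL (qL B a b) := by
  induction a using Finsupp.induction_linear with
  | zero => simp
  | add f g hf hg => simp only [map_add, LinearMap.add_apply, hf, hg]
  | single m u =>
    induction b using Finsupp.induction_linear with
    | zero => simp
    | add f g hf hg => simp only [map_add, hf, hg]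
    | single n v =>
      rw [DL_single, qL_single, qL_single, map_smul, ← Module.End.mul_apply (ldL : LP V →ₗ[ℂ] LP V),
        ← (comm_ld.pow_left m).eq, Module.End.mul_apply, pow_succ' ldL n, Module.End.mul_apply]

/-- The substitution `λ ↦ -λ-∂` as a linear map. -/
noncomputable def nL : LP V →ₗ[ℂ] LP V :=
  Finsupp.lsum ℂ fun n => ((-1 : ℂ) ^ n) • ((ldL ^ n : LP V →ₗ[ℂ] LP V) ∘ₗ (Finsupp.lsingle 0 : Conf V →ₗ[ℂ] LP V))

lemma nL_single (n : ℕ) (c : Conf V) :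
    nL (Finsupp.single n c) = ((-1 : ℂ) ^ n) • (ldL ^ n) (Finsupp.single 0 c) := by
  simp [nL]

lemma nsubst_eq (P : LP V) : nsubst P = nL P := by
  conv_rhs => rw [← Finsupp.sum_single P]
  simp only [Finsupp.sum, map_sum, nL_single, nsubst, ldOp_eq, Module.End.pow_apply]

lemma nL_lL (P : LP V) : nL (lL P) = - ldL (nL P) := by
  induction P using Finsupp.induction_linear with
  | zero => simp
  | add f g hf hg => simp only [map_add, hf, hg]; abel
  | single n c =>
    rw [lL_single, nL_single, nL_single, map_smul, pow_succ' ldL, Module.End.mul_apply, pow_succ]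
    module

lemma nL_dL (P : LP V) : nL (dL P) = dL (nL P) := by
  induction P using Finsupp.induction_linear with
  | zero => simp
  | add f g hf hg => simp only [map_add, hf, hg]
  | single n c =>
    rw [dL_single, nL_single, nL_single, map_smul, ← dL_single, ← Module.End.mul_apply,
      ← Module.End.mul_apply, (comm_dld.pow_right n).eq]

lemma nL_ldL (P : LP V) : nL (ldL P) = - lL (nL P) := by
  have : ldL P = lL P + dL P := rfl
  rw [this, map_add, nL_lL, nL_dL]
  have : ldL (nL P) = lL (nL P) + dL (nL P) := rfl
  rw [this]; abel

/-- Evaluation of a `λ`-polynomial at `λ = l`. -/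
noncomputable def ev (l : ℂ) : LP V →ₗ[ℂ] Conf V :=
  Finsupp.lsum ℂ fun n => (l ^ n) • LinearMap.id

lemma ev_single (l : ℂ) (n : ℕ) (c : Conf V) : ev l (Finsupp.single n c) = l ^ n • c := by
  simp [ev]

lemma ev_lL (l : ℂ) (P : LP V) : ev l (lL P) = l • ev l P := by
  induction P using Finsupp.induction_linear with
  | zero => simp
  | add f g hf hg => simp only [map_add, hf, hg, smul_add]
  | single n c => rw [lL_single, ev_single, ev_single, pow_succ', mul_smul]

lemma ev_dL (l : ℂ) (P : LP V) : ev l (dL P) = DL (ev l P) := by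
  induction P using Finsupp.induction_linear with
  | zero => simp
  | add f g hf hg => simp only [map_add, hf, hg]
  | single n c => rw [dL_single, ev_single, ev_single, map_smul]

lemma ev_ldL (l : ℂ) (P : LP V) : ev l (ldL P) = l • ev l P + DL (ev l P) := by
  have : ldL P = lL P + dL P := rfl
  rw [this, map_add, ev_lL, ev_dL]

/-- The bracket evaluated at `λ = l`. -/
noncomputable def br (B : V →ₗ[ℂ] V →ₗ[ℂ] LP V) (l : ℂ) : Conf V →ₗ[ℂ] Conf V →ₗ[ℂ] Conf V :=
  (qL B).compr₂ (ev l)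

lemma br_def (B : V →ₗ[ℂ] V →ₗ[ℂ] LP V) (l : ℂ) (a b : Conf V) :
    br B l a b = ev l (qL B a b) := rfl

lemma br_D_left (B : V →ₗ[ℂ] V →ₗ[ℂ] LP V) (l : ℂ) (a b : Conf V) :
    br B l (DL a) b = - (l • br B l a b) := by
  simp only [br_def, qL_D_left, map_neg, ev_lL]

lemma br_D_right (B : V →ₗ[ℂ] V →ₗ[ℂ] LP V) (l : ℂ) (a b : Conf V) :
    br B l a (DL b) = l • br B l a b + DL (br B l a b) := by
  simp only [br_def, qL_D_right, ev_ldL]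

/-- Induction principle on `ℂ[∂]V` for `V` with a basis. -/
lemma conf_ind {ι : Type} {P : Conf (ι →₀ ℂ) → Prop}
    (h0 : P 0) (hadd : ∀ a b, P a → P b → P (a + b)) (hsmul : ∀ (k : ℂ) a, P a → P (k • a))
    (hD : ∀ a, P a → P (DL a)) (hx : ∀ i, P (Finsupp.single 0 (Finsupp.single i 1))) :
    ∀ a, P a := by
  intro a
  induction a using Finsupp.induction_linear with
  | zero => exact h0
  | add f g hf hg => exact hadd _ _ hf hg
  | single n v =>
    induction n with
    | zero =>
      induction v using Finsupp.induction_linear with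
      | zero => simpa using h0
      | add f g hf hg => rw [Finsupp.single_add]; exact hadd _ _ hf hg
      | single i c =>
        have := hsmul c _ (hx i)
        simpa using this
    | succ n ih => rw [← DL_single]; exact hD _ ih

/-- Evaluation as a finite sum. -/
lemma ev_eq_sum (l : ℂ) (P : LP V) (N : ℕ) (h : ∀ n, N ≤ n → P n = 0) :
    ev l P = ∑ n ∈ Finset.range N, l ^ n • P n := by
  rw [ev, Finsupp.lsum_apply, Finsupp.sum]
  refine Finset.sum_subset ?_ ?_
  · intro n hn
    rw [Finset.mem_range]
    by_contra hc
    exact (Finsupp.mem_support_iff.1 hn) (h n (not_lt.1 hc))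
  · intro n _ hn
    rw [Finsupp.notMem_support_iff.1 hn]; simp

lemma exists_bound {W : Type} [AddCommGroup W] (P : ℕ →₀ W) : ∃ N, ∀ n, N ≤ n → P n = 0 := by
  refine ⟨P.support.sup id + 1, fun n hn => ?_⟩
  by_contra hc
  have := Finset.le_sup (f := id) (Finsupp.mem_support_iff.2 hc)
  simp at this; omega

/-- A common bound for iterated brackets. -/
lemma exists_bound₂ (P : LP V) (f : Conf V →ₗ[ℂ] LP V) :
    ∃ N, (∀ n, N ≤ n → P n = 0) ∧ ∀ k n, N ≤ n → f (P k) n = 0 := by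
  obtain ⟨N, hN⟩ := exists_bound P
  choose M hM using fun k => exists_bound (f (P k))
  refine ⟨max N ((Finset.range N).sup M), fun n hn => hN n (le_trans (le_max_left _ _) hn),
    fun k n hn => ?_⟩
  by_cases hk : k < N
  · exact hM k n (le_trans (le_trans (Finset.le_sup (Finset.mem_range.2 hk)) (le_max_right _ _)) hn)
  · rw [hN k (not_lt.1 hk)]; simp

lemma ev_ev (l m : ℂ) (P : LP V) (f : Conf V →ₗ[ℂ] LP V) (N : ℕ)
    (h1 : ∀ n, N ≤ n → P n = 0) (h2 : ∀ k n, N ≤ n → f (P k) n = 0) :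
    ev l (f (ev m P)) =
      ∑ q ∈ Finset.range N, ∑ p ∈ Finset.range N, (m ^ q * l ^ p) • f (P q) p := by
  rw [ev_eq_sum m P N h1, map_sum, map_sum]
  refine Finset.sum_congr rfl fun q _ => ?_
  rw [map_smul, map_smul, ev_eq_sum l _ N (h2 q), Finset.smul_sum]
  exact Finset.sum_congr rfl fun p _ => by rw [mul_smul]

open Polynomial in
/-- Scalar coefficient extraction. -/
lemma coeff_extract (N : ℕ) (f g h : ℕ → ℕ → ℂ)
    (hf : ∀ q p, (N ≤ q ∨ N ≤ p) → f q p = 0)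
    (hg : ∀ q p, (N ≤ q ∨ N ≤ p) → g q p = 0)
    (hh : ∀ q p, (N ≤ q ∨ N ≤ p) → h q p = 0)
    (H : ∀ l m : ℂ,
      ∑ q ∈ Finset.range N, ∑ p ∈ Finset.range N, (m ^ q * l ^ p) * f q p =
      (∑ k ∈ Finset.range N, ∑ n ∈ Finset.range N, (l ^ k * (l + m) ^ n) * g k n) +
      ∑ p ∈ Finset.range N, ∑ q ∈ Finset.range N, (l ^ p * m ^ q) * h p q) (p q : ℕ) :
    f q p = (∑ n ∈ Finset.Icc q (p + q), (n.choose q : ℂ) * g (p + q - n) n) + h p q := by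
  have key : (∑ q ∈ Finset.range N, ∑ p ∈ Finset.range N,
        ((X : ℂ[X][X]) ^ q * C (X ^ p)) * C (C (f q p))) =
      (∑ k ∈ Finset.range N, ∑ n ∈ Finset.range N,
        (C (X ^ k) * (X + C X) ^ n) * C (C (g k n))) +
      ∑ p ∈ Finset.range N, ∑ q ∈ Finset.range N, (C (X ^ p) * X ^ q) * C (C (h p q)) := by
    have hinj : Function.Injective (fun c : ℂ => (C c : ℂ[X])) := C_injective
    refine Polynomial.eq_of_infinite_eval_eq _ _
      ((Set.infinite_range_of_injective hinj).mono ?_)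
    rintro _ ⟨m, rfl⟩
    refine Polynomial.funext fun l => ?_
    have := H l m
    simp only [eval_finsetSum, eval_add, eval_mul, eval_pow, eval_X, eval_C]
    rw [this]
    congr 1
    simp only [add_comm l m]
  have key2 := congrArg (fun P : ℂ[X][X] => (P.coeff q).coeff p) key
  simp only [coeff_add, finsetSum_coeff] at key2
  have e1 : (∑ q' ∈ Finset.range N, ∑ p' ∈ Finset.range N,
      (((X : ℂ[X][X]) ^ q' * C (X ^ p') * C (C (f q' p'))).coeff q).coeff p) = f q p := by
    simp only [coeff_mul_C, coeff_X_pow, ite_mul, zero_mul, one_mul]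
    by_cases hq : q < N
    · rw [Finset.sum_eq_single q]
      · by_cases hp : p < N
        · rw [Finset.sum_eq_single p] <;> simp_all [coeff_X_pow]
          intro b _ hb hb2
          exact absurd hb2.symm hb
        · rw [hf q p (Or.inr (not_lt.1 hp))]
          refine Finset.sum_eq_zero fun p' hp' => ?_
          have : p ≠ p' := by rintro rfl; simp at hp'; omega
          simp [coeff_X_pow, this]
      · intro q' _ hq'
        simp [Ne.symm hq']
      · simp [hq]
    · rw [hf q p (Or.inl (not_lt.1 hq))]
      refine Finset.sum_eq_zero fun q' hq' => ?_
      have : q ≠ q' := by rintro rfl; simp at hq'; omega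
      simp [this]
  have e3 : (∑ p' ∈ Finset.range N, ∑ q' ∈ Finset.range N,
      ((C (X ^ p') * (X : ℂ[X][X]) ^ q' * C (C (h p' q'))).coeff q).coeff p) = h p q := by
    simp only [coeff_mul_C, coeff_C_mul, coeff_X_pow]
    by_cases hp : p < N
    · rw [Finset.sum_eq_single p]
      · by_cases hq : q < N
        · rw [Finset.sum_eq_single q]
          · simp
          · intro b _ hb
            simp [Ne.symm hb]
          · simp [hq]
        · rw [hh p q (Or.inr (not_lt.1 hq))]
          refine Finset.sum_eq_zero fun q' hq' => ?_
          have : q ≠ q' := by rintro rfl; simp at hq'; omega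
          simp [this]
      · intro p' _ hp'
        refine Finset.sum_eq_zero fun q' hq' => ?_
        split_ifs <;> simp [coeff_X_pow, Ne.symm hp']
      · simp [hp]
    · rw [hh p q (Or.inl (not_lt.1 hp))]
      refine Finset.sum_eq_zero fun p' hp' => Finset.sum_eq_zero fun q' hq' => ?_
      have : p ≠ p' := by rintro rfl; simp at hp'; omega
      split_ifs <;> simp [coeff_X_pow, this]
  have e2 : (∑ k ∈ Finset.range N, ∑ n ∈ Finset.range N,
        ((C (X ^ k) * ((X : ℂ[X][X]) + C X) ^ n * C (C (g k n))).coeff q).coeff p) =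
      ∑ n ∈ Finset.Icc q (p + q), (n.choose q : ℂ) * g (p + q - n) n := by
    have step : ∀ k n, ((C (X ^ k) * ((X : ℂ[X][X]) + C X) ^ n * C (C (g k n))).coeff q).coeff p =
        if q ≤ n ∧ k + n = p + q then (n.choose q : ℂ) * g k n else 0 := by
      intro k n
      rw [coeff_mul_C, coeff_C_mul, coeff_X_add_C_pow, ← mul_assoc, ← pow_add, coeff_mul_C,
        coeff_mul_natCast, coeff_X_pow]
      by_cases hqn : q ≤ n
      · have : p = k + (n - q) ↔ (q ≤ n ∧ k + n = p + q) := by omega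
        simp only [this, ite_mul, one_mul, zero_mul]
      · simp [hqn, Nat.choose_eq_zero_of_lt (not_le.1 hqn)]
    simp only [step]
    rw [Finset.sum_comm]
    have inner : ∀ n, (∑ k ∈ Finset.range N,
        if q ≤ n ∧ k + n = p + q then (n.choose q : ℂ) * g k n else 0) =
        if n ∈ Finset.Icc q (p + q) then (n.choose q : ℂ) * g (p + q - n) n else 0 := by
      intro n
      by_cases hn : n ∈ Finset.Icc q (p + q)
      · rw [if_pos hn]
        rw [Finset.mem_Icc] at hn
        rw [Finset.sum_eq_single (p + q - n)]
        · rw [if_pos (by omega)]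
        · intro k _ hk
          rw [if_neg (by omega)]
        · intro hk
          rw [hg _ _ (Or.inl (by simpa using hk))]; simp
      · rw [if_neg hn]
        rw [Finset.mem_Icc] at hn
        refine Finset.sum_eq_zero fun k _ => if_neg (by omega)
    simp only [inner]
    rw [← Finset.sum_filter]
    refine Finset.sum_subset ?_ ?_
    · intro n hn
      exact (Finset.mem_filter.1 hn).2
    · intro n hn hn'
      have : N ≤ n := by
        by_contra hc
        exact hn' (Finset.mem_filter.2 ⟨Finset.mem_range.2 (not_le.1 hc), hn⟩)
      rw [hg _ _ (Or.inr this), mul_zero]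
  rw [e1, e2, e3] at key2
  exact key2

/-- The evaluated Jacobi identity implies the coefficientwise one. -/
lemma jacobi_coeff {ι : Type} (B : (ι →₀ ℂ) →ₗ[ℂ] (ι →₀ ℂ) →ₗ[ℂ] LP (ι →₀ ℂ))
    (a b c : Conf (ι →₀ ℂ))
    (H : ∀ l m : ℂ, br B l a (br B m b c) = br B (l + m) (br B l a b) c + br B m b (br B l a c))
    (p q : ℕ) :
    qL B a (qL B b c q) p =
      (∑ n ∈ Finset.Icc q (p + q), (n.choose q : ℂ) • qL B (qL B a b (p + q - n)) c n)
      + qL B b (qL B a c p) q := by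
  obtain ⟨N₁, h11, h12⟩ := exists_bound₂ (qL B b c) (qL B a)
  obtain ⟨N₂, h21, h22⟩ := exists_bound₂ (qL B a b) ((qL B).flip c)
  obtain ⟨N₃, h31, h32⟩ := exists_bound₂ (qL B a c) (qL B b)
  set N := max N₁ (max N₂ N₃) with hN
  have l1 : N₁ ≤ N := le_max_left _ _
  have l2 : N₂ ≤ N := (le_max_left _ _).trans (le_max_right _ _)
  have l3 : N₃ ≤ N := (le_max_right _ _).trans (le_max_right _ _)
  have b11 : ∀ n, N ≤ n → qL B b c n = 0 := fun n hn => h11 n (l1.trans hn)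
  have b12 : ∀ k n, N ≤ n → qL B a (qL B b c k) n = 0 := fun k n hn => h12 k n (l1.trans hn)
  have b21 : ∀ n, N ≤ n → qL B a b n = 0 := fun n hn => h21 n (l2.trans hn)
  have b22 : ∀ k n, N ≤ n → (qL B).flip c (qL B a b k) n = 0 :=
    fun k n hn => h22 k n (l2.trans hn)
  have b31 : ∀ n, N ≤ n → qL B a c n = 0 := fun n hn => h31 n (l3.trans hn)
  have b32 : ∀ k n, N ≤ n → qL B b (qL B a c k) n = 0 := fun k n hn => h32 k n (l3.trans hn)
  ext d γ
  have := coeff_extract N (fun q p => qL B a (qL B b c q) p d γ)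
    (fun k n => qL B (qL B a b k) c n d γ) (fun p q => qL B b (qL B a c p) q d γ)
    (by
      rintro q p (h | h)
      · simp [b11 q h]
      · simp [b12 q p h])
    (by
      rintro q p (h | h)
      · simp [b21 q h]
      · have := b22 q p h
        simp only [LinearMap.flip_apply] at this
        simp [this])
    (by
      rintro q p (h | h)
      · simp [b31 q h]
      · simp [b32 q p h])
    (by
      intro l m
      have h := H l m
      have e1 := ev_ev l m (qL B b c) (qL B a) N b11 b12
      have e2 := ev_ev (l + m) l (qL B a b) ((qL B).flip c) N b21 b22
      have e3 := ev_ev m l (qL B a c) (qL B b) N b31 b32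
      simp only [LinearMap.flip_apply] at e2
      simp only [br_def] at h
      rw [e1, e2, e3] at h
      have h' := congrArg (fun x : Conf (ι →₀ ℂ) => x d γ) h
      simpa [Finsupp.finsetSum_apply] using h') p q
  simpa [Finsupp.finsetSum_apply] using this

section concrete

variable (Δ : AddSubgroup ℂ) (b : ℂ) (φ : Δ →+ ℂ)

/-- Constant term. -/
noncomputable def cc (α β : Δ) : ℂ :=
  (1 / b) * (φ α * (β : ℂ) - φ β * (α : ℂ) + b * (φ α - φ β))

/-- Generator. -/
noncomputable def gx (α : Δ) : Conf (Δ →₀ ℂ) := Finsupp.single 0 (Finsupp.single α 1)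

/-- Bracket of generators. -/
noncomputable def KK (α β : Δ) : LP (Δ →₀ ℂ) :=
    (Finsupp.single 0
        (Finsupp.single 1 (((α : ℂ) + b) • Finsupp.single (α + β) (1 : ℂ))
          + Finsupp.single 0
              (((1 / b) * (φ α * (β : ℂ) - φ β * (α : ℂ) + b * (φ α - φ β)))
                • Finsupp.single (α + β) (1 : ℂ)))
      + Finsupp.single 1
          (Finsupp.single 0
            (((α : ℂ) + (β : ℂ) + 2 * b) • Finsupp.single (α + β) (1 : ℂ))))

/-- `B2` as a bilinear map. -/
noncomputable def BL : (Δ →₀ ℂ) →ₗ[ℂ] (Δ →₀ ℂ) →ₗ[ℂ] LP (Δ →₀ ℂ) :=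
  Finsupp.linearCombination ℂ fun α => Finsupp.linearCombination ℂ fun β => KK Δ b φ α β

lemma BL_eq : B2 Δ b φ = fun u v => BL Δ b φ u v := by
  funext u v
  simp only [BL, Finsupp.linearCombination_apply, Finsupp.sum, LinearMap.sum_apply,
    LinearMap.smul_apply, B2, Finset.smul_sum, mul_smul, KK]

lemma qbr_B2 (x y : Conf (Δ →₀ ℂ)) : qbr (B2 Δ b φ) x y = qL (BL Δ b φ) x y := by
  rw [BL_eq, qbr_eq]

lemma KK_eq (α β : Δ) : KK Δ b φ α β =
    Finsupp.single 0 (((α : ℂ) + b) • DL (gx Δ (α + β)) + cc Δ b φ α β • gx Δ (α + β)) +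
    Finsupp.single 1 (((α : ℂ) + β + 2 * b) • gx Δ (α + β)) := by
  simp only [KK, gx, DL_single, cc, Finsupp.smul_single]

lemma BL_gen (α β : Δ) : BL Δ b φ (Finsupp.single α 1) (Finsupp.single β 1) = KK Δ b φ α β := by
  simp [BL]

lemma qL_gx (α β : Δ) : qL (BL Δ b φ) (gx Δ α) (gx Δ β) = KK Δ b φ α β := by
  rw [gx, gx, qL_single, BL_gen]; simp

lemma br_gx (l : ℂ) (α β : Δ) : br (BL Δ b φ) l (gx Δ α) (gx Δ β) =
    ((α : ℂ) + b) • DL (gx Δ (α + β)) +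
      (cc Δ b φ α β + l * ((α : ℂ) + β + 2 * b)) • gx Δ (α + β) := by
  rw [br_def, qL_gx, KK_eq, map_add, ev_single, ev_single]
  module

lemma cc_skew (α β : Δ) : cc Δ b φ α β = - cc Δ b φ β α := by
  simp only [cc]; ring

lemma skew (x y : Conf (Δ →₀ ℂ)) :
    qL (BL Δ b φ) x y = - nL (qL (BL Δ b φ) y x) := by
  induction x using conf_ind with
  | h0 => simp
  | hadd u v hu hv => simp only [map_add, LinearMap.add_apply, hu, hv]; abel
  | hsmul k u hu => simp only [map_smul, LinearMap.smul_apply, hu, smul_neg]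
  | hD u hu => rw [qL_D_left, qL_D_right, hu, nL_ldL]; simp
  | hx α =>
    induction y using conf_ind with
    | h0 => simp
    | hadd u v hu hv => simp only [map_add, LinearMap.add_apply, hu, hv]; abel
    | hsmul k u hu => simp only [map_smul, LinearMap.smul_apply, hu, smul_neg]
    | hD u hu => rw [qL_D_left, qL_D_right, hu, map_neg, map_neg, nL_lL, neg_neg]
    | hx β =>
      have h := qL_gx Δ b φ α β
      have h' := qL_gx Δ b φ β α
      rw [gx, gx] at h h'
      rw [h, h', KK_eq, KK_eq, map_add, nL_single, nL_single, add_comm β α, cc_skew]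
      have e : ∀ c : Conf (Δ →₀ ℂ), ldL (Finsupp.single 0 c) =
          Finsupp.single 1 c + Finsupp.single 0 (DL c) := by
        intro c
        simp [ldL, lL_single, dL_single]
      simp only [pow_zero, pow_one, Module.End.one_apply, e, one_smul, map_smul]
      simp only [Finsupp.single_add, ← Finsupp.smul_single, neg_smul, Finsupp.single_neg]
      module

lemma jacobi_ev (hb : b ≠ 0) (x y z : Conf (Δ →₀ ℂ)) (l m : ℂ) :
    br (BL Δ b φ) l x (br (BL Δ b φ) m y z) =
      br (BL Δ b φ) (l + m) (br (BL Δ b φ) l x y) z +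
        br (BL Δ b φ) m y (br (BL Δ b φ) l x z) := by
  induction x using conf_ind with
  | h0 => simp
  | hadd u v hu hv => simp only [map_add, LinearMap.add_apply, hu, hv]; abel
  | hsmul k u hu => simp only [map_smul, LinearMap.smul_apply, hu, smul_add]
  | hD u hu =>
    simp only [br_D_left, map_neg, map_smul, LinearMap.neg_apply, LinearMap.smul_apply, hu]
    module
  | hx α =>
    induction y using conf_ind with
    | h0 => simp
    | hadd u v hu hv => simp only [map_add, LinearMap.add_apply, hu, hv]; abel
    | hsmul k u hu => simp only [map_smul, LinearMap.smul_apply, hu, smul_add]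
    | hD u hu =>
      simp only [br_D_left, br_D_right, map_neg, map_smul, map_add, LinearMap.neg_apply,
        LinearMap.add_apply, LinearMap.smul_apply, hu]
      module
    | hx β =>
      induction z using conf_ind with
      | h0 => simp
      | hadd u v hu hv => simp only [map_add, hu, hv]; abel
      | hsmul k u hu => simp only [map_smul, hu, smul_add]
      | hD u hu =>
        simp only [br_D_right, map_smul, map_add, hu]
        module
      | hx γ =>
        change br (BL Δ b φ) l (gx Δ α) (br (BL Δ b φ) m (gx Δ β) (gx Δ γ)) =
          br (BL Δ b φ) (l + m) (br (BL Δ b φ) l (gx Δ α) (gx Δ β)) (gx Δ γ) +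
          br (BL Δ b φ) m (gx Δ β) (br (BL Δ b φ) l (gx Δ α) (gx Δ γ))
        simp only [br_gx, br_D_left, br_D_right, map_add, map_smul, LinearMap.add_apply,
          LinearMap.smul_apply]
        rw [show α + β + γ = α + (β + γ) by abel, show β + (α + γ) = α + (β + γ) by abel]
        simp only [cc, map_add, AddSubgroup.coe_add]
        match_scalars <;> field_simp <;> ring

/-- The diagonal operator `x_β ↦ (β+2b) x_β`. -/
noncomputable def TT : (Δ →₀ ℂ) →ₗ[ℂ] (Δ →₀ ℂ) :=
  Finsupp.lsum ℂ fun β => ((β : ℂ) + 2 * b) • Finsupp.lsingle β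

lemma TT_apply (v : Δ →₀ ℂ) (β : Δ) : TT Δ b v β = ((β : ℂ) + 2 * b) * v β := by
  induction v using Finsupp.induction_linear with
  | zero => simp
  | add f g hf hg => simp only [map_add, Finsupp.add_apply, hf, hg]; ring
  | single γ c =>
    by_cases h : γ = β
    · subst h; simp [TT]
    · simp [TT, Finsupp.single_apply, h]

lemma BL_zero_one (v : Δ →₀ ℂ) :
    BL Δ b φ (Finsupp.single 0 1) v 1 = Finsupp.single 0 (TT Δ b v) := by
  induction v using Finsupp.induction_linear with
  | zero => simp
  | add f g hf hg => simp only [map_add, Finsupp.add_apply, hf, hg, Finsupp.single_add]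
  | single γ c =>
    simp only [BL, KK, TT, Finsupp.linearCombination_single, one_smul, Finsupp.smul_apply,
      Finsupp.add_apply, Finsupp.lsum_single, LinearMap.smul_apply, Finsupp.lsingle_apply,
      Finsupp.smul_single, zero_add, smul_eq_mul, mul_one, Finsupp.single_eq_same,
      AddSubgroup.coe_zero]
    rw [Finsupp.single_eq_of_ne (by norm_num : (1 : ℕ) ≠ 0), zero_add, Finsupp.smul_single,
      Finsupp.smul_single, smul_eq_mul, mul_comm]

lemma BL_high (u v : Δ →₀ ℂ) (k : ℕ) (hk : 1 < k) : BL Δ b φ u v k = 0 := by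
  induction u using Finsupp.induction_linear with
  | zero => simp
  | add f g hf hg => simp only [map_add, LinearMap.add_apply, Finsupp.add_apply, hf, hg, add_zero]
  | single α c =>
    induction v using Finsupp.induction_linear with
    | zero => simp
    | add f g hf hg => simp only [map_add, Finsupp.add_apply, hf, hg, add_zero]
    | single γ d =>
      have h0 : (0 : ℕ) ≠ k := by omega
      have h1 : (1 : ℕ) ≠ k := by omega
      simp [BL, KK, Finsupp.single_apply, h0, h1]

lemma ld_pow (P : LP (Δ →₀ ℂ)) (hP : ∀ k, 1 < k → P k = 0) (n : ℕ) :
    ((ldL ^ n) P) (n + 1) = P 1 ∧ ∀ k, n + 1 < k → ((ldL ^ n) P) k = 0 := by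
  induction n with
  | zero => exact ⟨rfl, fun k hk => by simpa using hP k (by omega)⟩
  | succ n ih =>
    rw [pow_succ' ldL, Module.End.mul_apply]
    refine ⟨?_, ?_⟩
    · rw [ldL_succ_apply, ih.1, ih.2 (n + 1 + 1) (by omega)]; simp
    · intro k hk
      obtain ⟨j, rfl⟩ : ∃ j, k = j + 1 := ⟨k - 1, by omega⟩
      rw [ldL_succ_apply, ih.2 j (by omega), ih.2 (j + 1) (by omega)]; simp

lemma top_coeff (x : Conf (Δ →₀ ℂ)) (N : ℕ) (hN : ∀ n, N < n → x n = 0) :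
    qL (BL Δ b φ) (gx Δ 0) x (N + 1) = Finsupp.single 0 (TT Δ b (x N)) := by
  have hs : x = ∑ n ∈ Finset.range (N + 1), Finsupp.single n (x n) := by
    conv_lhs => rw [← Finsupp.sum_single x]
    rw [Finsupp.sum]
    refine Finset.sum_subset ?_ ?_
    · intro n hn
      rw [Finset.mem_range]
      by_contra hc
      exact (Finsupp.mem_support_iff.1 hn) (hN n (by omega))
    · intro n _ hn
      rw [Finsupp.notMem_support_iff.1 hn]; simp
  conv_lhs => rw [hs]
  rw [map_sum, Finsupp.finsetSum_apply, Finset.sum_range_succ, Finset.sum_eq_zero, zero_add]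
  · rw [gx, qL_single, pow_zero, pow_zero, one_smul, Module.End.one_apply,
      (ld_pow Δ _ (BL_high Δ b φ _ _) N).1, BL_zero_one]
  · intro n hn
    rw [gx, qL_single, pow_zero, pow_zero, one_smul, Module.End.one_apply]
    exact (ld_pow Δ _ (BL_high Δ b φ _ _) n).2 _ (by simp at hn; omega)

lemma coef_ne (h2b : 2 * b ∉ Δ) (β : Δ) : (β : ℂ) + 2 * b ≠ 0 := by
  intro h
  apply h2b
  have : 2 * b = -(β : ℂ) := by linear_combination h
  rw [this]
  exact Δ.neg_mem β.2

lemma exists_gen (J : Submodule ℂ (Δ →₀ ℂ)) (hJ : ∀ v ∈ J, TT Δ b v ∈ J) :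
    ∀ (n : ℕ) (v : Δ →₀ ℂ), v.support.card ≤ n → v ∈ J → v ≠ 0 →
      ∃ β, Finsupp.single β (1 : ℂ) ∈ J := by
  intro n
  induction n with
  | zero =>
    intro v hc _ h0
    exact absurd (by simpa using hc) h0
  | succ n ih =>
    intro v hc hv h0
    obtain ⟨β, hβ⟩ := Finsupp.support_nonempty_iff.2 h0
    set w := TT Δ b v - ((β : ℂ) + 2 * b) • v with hw
    have hwJ : w ∈ J := J.sub_mem (hJ v hv) (J.smul_mem _ hv)
    have hwa : ∀ γ, w γ = ((γ : ℂ) - β) * v γ := by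
      intro γ
      simp only [hw, Finsupp.sub_apply, TT_apply, Finsupp.smul_apply, smul_eq_mul]; ring
    by_cases hw0 : w = 0
    · refine ⟨β, ?_⟩
      have hvs : v = Finsupp.single β (v β) := by
        ext γ
        by_cases h : β = γ
        · subst h; simp
        · have := hwa γ
          rw [hw0] at this
          have hne : (γ : ℂ) - β ≠ 0 := by
            intro hh
            exact h (Subtype.ext (sub_eq_zero.1 hh).symm)
          have : v γ = 0 := by simpa [hne] using this.symm
          rw [this, Finsupp.single_apply, if_neg h]
      have := J.smul_mem (v β)⁻¹ hv
      rw [hvs] at this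
      simpa [Finsupp.mem_support_iff.1 hβ] using this
    · refine ih w ?_ hwJ hw0
      have hlt : w.support ⊂ v.support := by
        rw [Finset.ssubset_iff_of_subset]
        · exact ⟨β, hβ, by simp [hwa]⟩
        · intro γ hγ
          rw [Finsupp.mem_support_iff] at hγ ⊢
          intro h
          exact hγ (by rw [hwa, h, mul_zero])
      have := Finset.card_lt_card hlt
      omega

lemma simple (h2b : 2 * b ∉ Δ) : ConfSimple (B2 Δ b φ) := by
  refine ⟨⟨gx Δ 0, gx Δ 0, ?_⟩, ?_⟩
  · intro h
    rw [qbr_B2, qL_gx] at h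
    have := congrArg (fun P : LP (Δ →₀ ℂ) => P 1 0 0) h
    have h0 := coef_ne Δ b h2b 0
    simp [KK] at this
    simp [this] at h0
  · intro I ⟨hD, hI⟩
    by_cases hbot : I = ⊥
    · exact Or.inl hbot
    right
    obtain ⟨x, hxI, hx0⟩ := (Submodule.ne_bot_iff I).1 hbot
    have hI' : ∀ u, ∀ x ∈ I, ∀ n, qL (BL Δ b φ) u x n ∈ I := by
      intro u x hx n
      rw [← qbr_B2]; exact hI u x hx n
    set J : Submodule ℂ (Δ →₀ ℂ) := I.comap (Finsupp.lsingle 0) with hJdef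
    have memJ : ∀ v, v ∈ J ↔ Finsupp.single 0 v ∈ I := fun v => Iff.rfl
    have hJ : ∀ v ∈ J, TT Δ b v ∈ J := by
      intro v hv
      have h := hI' (gx Δ 0) _ ((memJ v).1 hv) (0 + 1)
      rw [top_coeff Δ b φ (Finsupp.single 0 v) 0 (by
        intro n hn; rw [Finsupp.single_apply, if_neg (by omega)])] at h
      rw [memJ]
      simpa using h
    have hne := Finsupp.support_nonempty_iff.2 hx0
    set N := x.support.max' hne with hNdef
    have hNm : x N ≠ 0 := Finsupp.mem_support_iff.1 (Finset.max'_mem _ hne)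
    have hNt : ∀ n, N < n → x n = 0 := by
      intro n hn
      by_contra hc
      exact absurd (Finset.le_max' _ n (Finsupp.mem_support_iff.2 hc)) (not_le.2 hn)
    have hv : TT Δ b (x N) ∈ J := by
      rw [memJ, ← top_coeff Δ b φ x N hNt]
      exact hI' _ _ hxI _
    have hv0 : TT Δ b (x N) ≠ 0 := by
      intro h
      apply hNm
      ext β
      have := TT_apply Δ b (x N) β
      rw [h] at this
      simpa [coef_ne Δ b h2b β] using this.symm
    obtain ⟨β, hβ⟩ := exists_gen Δ b J hJ _ _ le_rfl hv hv0
    have hall : ∀ γ, gx Δ γ ∈ I := by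
      intro γ
      have h := hI' (gx Δ (γ - β)) (gx Δ β) ((memJ _).1 hβ) 1
      rw [qL_gx, KK_eq, sub_add_cancel] at h
      have h' : (((γ - β : Δ) : ℂ) + β + 2 * b) • gx Δ γ ∈ I := by simpa using h
      have hc : (((γ - β : Δ) : ℂ) + β + 2 * b) ≠ 0 := by
        have := coef_ne Δ b h2b γ
        simpa using this
      exact (I.smul_mem_iff hc).1 h'
    rw [eq_top_iff]
    intro y _
    induction y using conf_ind with
    | h0 => exact I.zero_mem
    | hadd u v hu hv => exact I.add_mem (hu trivial) (hv trivial)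
    | hsmul k u hu => exact I.smul_mem _ (hu trivial)
    | hD u hu => exact hD _ (hu trivial)
    | hx α => exact hall α

end concrete

end CL2

/-- if `2b ∉ Δ` and `φ : Δ → ℂ` is an additive group
homomorphism, then `CL₂(b,φ)` is a simple Lie conformal algebra. -/
theorem stmt_15 (Δ : AddSubgroup ℂ) (b : ℂ) (h2b : 2 * b ∉ Δ) (φ : Δ →+ ℂ) :
    IsLieConf (B2 Δ b φ) ∧ ConfSimple (B2 Δ b φ) := by
  have hb : b ≠ 0 := by
    rintro rfl
    exact h2b (by simp)
  refine ⟨⟨?_, ?_, ?_, ?_, ?_, ?_, ?_, ?_⟩, CL2.simple Δ b φ h2b⟩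
  · intro x y z
    simp only [CL2.qbr_B2, map_add, LinearMap.add_apply]
  · intro x y z
    simp only [CL2.qbr_B2, map_add]
  · intro k x y
    simp only [CL2.qbr_B2, map_smul, LinearMap.smul_apply]
  · intro k x y
    simp only [CL2.qbr_B2, map_smul]
  · intro x y
    simp only [CL2.qbr_B2, CL2.Dop_eq, CL2.lmul_eq, CL2.qL_D_left]
  · intro x y
    simp only [CL2.qbr_B2, CL2.Dop_eq, CL2.ldOp_eq, CL2.qL_D_right]
  · intro x y
    rw [CL2.qbr_B2, CL2.qbr_B2, CL2.nsubst_eq]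
    exact CL2.skew Δ b φ x y
  · intro x y z p q
    simp only [CL2.qbr_B2]
    exact CL2.jacobi_coeff _ x y z (CL2.jacobi_ev Δ b φ hb x y z) p q
end

section
/- Let Δ be an additive subgroup of ℂ and b ∈ ℂ with b ∉ Δ. Let [·,·] be any Lie bracket on A_3 such that (A_3,∘,[·,·]) is a Gel'fand-Dorfman bialgebra. Then there exist an additive group homomorphism φ : Δ → ℂ and a constant c ∈ ℂ such that [x_{α,i}, x_{β,j}] = (1/b)((α+b)φ(β) − (β+b)φ(α)) x_{α+β,i+j} + (1/b)(i(φ(β) − c(β+b)) + j(c(α+b) − φ(α))) x_{α+β,i+j−1} for all α,β ∈ Δ and i,j ∈ ℕ. -/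
set_option maxSynthPendingDepth 3

open QLCA

/-- The basis vector `x_{α,i}` of `A₃`. -/
noncomputable def x3 (Δ : AddSubgroup ℂ) (α : Δ) (i : ℕ) : (Δ × ℕ) →₀ ℂ :=
  Finsupp.single (α, i) 1

/-- The Novikov product of `A₃`:
`x_{α,i} ∘ x_{β,j} = (β+b) x_{α+β,i+j} + j x_{α+β,i+j−1}` (terms with second
index `−1` read as `0`; note the coefficient `j` vanishes there), extended
bilinearly. -/
noncomputable def A3mul (Δ : AddSubgroup ℂ) (b : ℂ) (u v : (Δ × ℕ) →₀ ℂ) :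
    (Δ × ℕ) →₀ ℂ :=
  Finsupp.sum u fun p up => Finsupp.sum v fun q vq => (up * vq) •
    (((q.1 : ℂ) + b) • x3 Δ (p.1 + q.1) (p.2 + q.2)
      + (q.2 : ℂ) • x3 Δ (p.1 + q.1) (p.2 + q.2 - 1))

lemma A3mul_x (Δ : AddSubgroup ℂ) (b : ℂ) (α β : Δ) (i j : ℕ) :
    A3mul Δ b (x3 Δ α i) (x3 Δ β j) = ((β : ℂ) + b) • x3 Δ (α + β) (i + j)
      + (j : ℂ) • x3 Δ (α + β) (i + j - 1) := by
  unfold A3mul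
  conv_lhs => rw [x3, x3]
  rw [Finsupp.sum_single_index, Finsupp.sum_single_index] <;> simp

lemma T_coeff (Δ : AddSubgroup ℂ) (b : ℂ) (hB : IsBilin (A3mul Δ b)) (w : (Δ × ℕ) →₀ ℂ)
    (β : Δ) (i : ℕ) :
    A3mul Δ b (x3 Δ 0 0) w (β, i) = ((β : ℂ) + b) * w (β, i) + ((i : ℂ) + 1) * w (β, i + 1) := by
  obtain ⟨-, hadd, -, hsm⟩ := hB
  induction w using Finsupp.induction_linear with
  | zero =>
    have := hsm 0 (x3 Δ 0 0) 0
    simp only [zero_smul] at this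
    simp [this]
  | add f g hf hg => rw [hadd]; simp only [Finsupp.add_apply, hf, hg]; ring
  | single p r =>
    obtain ⟨γ, k⟩ := p
    have h : Finsupp.single (γ, k) r = r • x3 Δ γ k := by simp [x3]
    rw [h, hsm, A3mul_x]
    simp only [x3, Finsupp.smul_apply, Finsupp.add_apply, smul_eq_mul, zero_add,
      Finsupp.single_apply, Prod.mk.injEq]
    by_cases hg : γ = β
    · subst hg
      rcases k with _ | k
      · by_cases hi : i = 0
        · subst hi; simp [mul_comm]
        · have : ¬ (0 = i) := fun h => hi h.symm
          simp [this]
      · simp only [true_and, Nat.add_sub_cancel, add_left_inj]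
        by_cases h1 : k + 1 = i
        · have h2 : ¬ k = i := by omega
          simp [h1, h2]; ring
        · by_cases h2 : k = i
          · subst h2; simp [mul_comm]
          · simp [h1, h2]
    · simp [hg]

lemma T_eigen (Δ : AddSubgroup ℂ) (b : ℂ) (hB : IsBilin (A3mul Δ b)) (w : (Δ × ℕ) →₀ ℂ)
    (γ : ℂ) (hw : A3mul Δ b (x3 Δ 0 0) w = γ • w) (β : Δ) (i : ℕ)
    (h : ¬ ((β : ℂ) + b = γ ∧ i = 0)) : w (β, i) = 0 := by
  have hc : ∀ k : ℕ, ((k : ℂ) + 1) * w (β, k + 1) = (γ - (β + b)) * w (β, k) := by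
    intro k
    have := T_coeff Δ b hB w β k
    rw [hw] at this
    simp only [Finsupp.smul_apply, smul_eq_mul] at this
    linear_combination -this
  by_cases hg : (β : ℂ) + b = γ
  · rcases i with _ | i
    · exact absurd ⟨hg, rfl⟩ h
    · have h1 := hc i
      rw [hg, sub_self, zero_mul] at h1
      exact (mul_eq_zero.mp h1).resolve_left (by exact_mod_cast Nat.succ_ne_zero i)
  · by_contra hne
    have hall : ∀ k, w (β, i + k) ≠ 0 := by
      intro k
      induction k with
      | zero => exact hne
      | succ k ih =>
        intro h0
        have h1 := hc (i + k)
        rw [show i + k + 1 = i + (k + 1) by ring, h0, mul_zero] at h1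
        rcases mul_eq_zero.mp h1.symm with h2 | h2
        · exact hg (sub_eq_zero.mp h2).symm
        · exact ih h2
    have hinj : Function.Injective (fun k : ℕ => ((β, i + k) : Δ × ℕ)) := by
      intro a c hac
      simpa using hac
    exact Set.infinite_of_injective_forall_mem (s := (w.support : Set (Δ × ℕ))) hinj
      (fun k => by simpa using hall k) (Finset.finite_toSet _)

lemma eigen_single (Δ : AddSubgroup ℂ) (b : ℂ) (hB : IsBilin (A3mul Δ b)) (w : (Δ × ℕ) →₀ ℂ)
    (α : Δ) (hw : A3mul Δ b (x3 Δ 0 0) w = ((α : ℂ) + b) • w) :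
    w = w (α, 0) • x3 Δ α 0 := by
  ext ⟨β, i⟩
  by_cases h : α = β ∧ 0 = i
  · obtain ⟨rfl, rfl⟩ := h
    simp [x3]
  · rw [T_eigen Δ b hB w _ hw β i]
    · simp [x3, Finsupp.single_apply, h]
    · rintro ⟨h1, h2⟩
      exact h ⟨Subtype.ext (add_right_cancel h1).symm, h2.symm⟩

/-- if `b ∉ Δ`, every Lie bracket making `(A₃,∘,[·,·])` a
Gel'fand-Dorfman bialgebra is of the form
`[x_{α,i}, x_{β,j}] = (1/b)((α+b)φ(β) − (β+b)φ(α)) x_{α+β,i+j}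
 + (1/b)(i(φ(β) − c(β+b)) + j(c(α+b) − φ(α))) x_{α+β,i+j−1}`
for some additive group homomorphism `φ : Δ → ℂ` and constant `c ∈ ℂ`. -/
theorem stmt_17 (Δ : AddSubgroup ℂ) (b : ℂ) (hb : b ∉ Δ)
    (lie : ((Δ × ℕ) →₀ ℂ) → ((Δ × ℕ) →₀ ℂ) → ((Δ × ℕ) →₀ ℂ))
    (hGD : IsGD (A3mul Δ b) lie) :
    ∃ (φ : Δ →+ ℂ) (c : ℂ), ∀ (α β : Δ) (i j : ℕ),
      lie (x3 Δ α i) (x3 Δ β j)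
        = ((1 / b) * (((α : ℂ) + b) * φ β - ((β : ℂ) + b) * φ α))
            • x3 Δ (α + β) (i + j)
          + ((1 / b) * ((i : ℂ) * (φ β - c * ((β : ℂ) + b))
              + (j : ℂ) * (c * ((α : ℂ) + b) - φ α)))
            • x3 Δ (α + β) (i + j - 1) := by
  have hb0 : b ≠ 0 := fun h => hb (h ▸ Δ.zero_mem)
  have hne : ∀ β : Δ, (β : ℂ) + b ≠ 0 := by
    intro β h
    apply hb
    rw [show b = -(β : ℂ) by linear_combination h]
    exact Δ.neg_mem β.2
  obtain ⟨⟨hB, -, -⟩, ⟨⟨lal, lar, lsl, lsr⟩, skew, -⟩, comp⟩ := hGD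
  obtain ⟨mal, mar, msl, msr⟩ := id hB
  have M := A3mul_x Δ b
  have subl : ∀ u v : (Δ × ℕ) →₀ ℂ, A3mul Δ b (x3 Δ 0 0) (u - v)
      = A3mul Δ b (x3 Δ 0 0) u - A3mul Δ b (x3 Δ 0 0) v := by
    intro u v
    rw [show u - v = u + (-1 : ℂ) • v by module, mar, msr]; module
  -- the element 1 and the derivation d
  have h11 : lie (x3 Δ 0 0) (x3 Δ 0 0) = 0 := by
    have h := skew (x3 Δ 0 0) (x3 Δ 0 0)
    exact self_eq_neg.mp h
  have m1 : ∀ a, A3mul Δ b a (x3 Δ 0 0) = b • a := by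
    intro a
    induction a using Finsupp.induction_linear with
    | zero =>
      have := msl 0 0 (x3 Δ 0 0)
      simpa using this
    | add f g hf hg => rw [mal, hf, hg, smul_add]
    | single p r =>
      obtain ⟨γ, k⟩ := p
      have h : Finsupp.single (γ, k) r = r • x3 Δ γ k := by simp [x3]
      rw [h, msl, M]
      simp only [add_zero, ZeroMemClass.coe_zero, Nat.cast_zero]
      module
  obtain ⟨d, hd⟩ : ∃ d : ((Δ × ℕ) →₀ ℂ) → ((Δ × ℕ) →₀ ℂ), ∀ a, d a = lie a (x3 Δ 0 0) :=
    ⟨_, fun _ => rfl⟩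
  have dadd : ∀ u v, d (u + v) = d u + d v := by intro u v; simp only [hd, lal]
  have dsm : ∀ (r : ℂ) u, d (r • u) = r • d u := by intro r u; simp only [hd, lsl]
  have dmul : ∀ a u, d (A3mul Δ b a u) = A3mul Δ b (d a) u + A3mul Δ b a (d u) := by
    intro a u
    have h := comp a u (x3 Δ 0 0)
    rw [m1, m1, lsl] at h
    simp only [hd]
    rw [← sub_eq_zero, ← h]
    module
  have d1 : d (x3 Δ 0 0) = 0 := by rw [hd, h11]
  have m0 : ∀ u, A3mul Δ b 0 u = 0 := by
    intro u
    have := msl 0 0 u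
    simpa using this
  have dT : ∀ u, d (A3mul Δ b (x3 Δ 0 0) u) = A3mul Δ b (x3 Δ 0 0) (d u) := by
    intro u
    rw [dmul, d1, m0, zero_add]
  obtain ⟨f, hf⟩ : ∃ f : Δ → ℂ, ∀ α, d (x3 Δ α 0) = f α • x3 Δ α 0 := by
    refine ⟨fun α => d (x3 Δ α 0) (α, 0), fun α => eigen_single Δ b hB _ α ?_⟩
    rw [← dT, M, ← dsm]
    simp
  have fadd : ∀ α β, f (α + β) = f α + f β := by
    intro α β
    have h := dmul (x3 Δ α 0) (x3 Δ β 0)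
    rw [M, hf, hf, msl, msr, M] at h
    simp only [Nat.cast_zero, zero_smul, add_zero, dsm, hf, smul_smul, ← add_smul] at h
    have h2 := DFunLike.congr_fun h (α + β, 0)
    simp [x3] at h2
    apply mul_left_cancel₀ (hne β)
    linear_combination h2
  obtain ⟨c, hc⟩ : ∃ c : ℂ, d (x3 Δ 0 1) = c • x3 Δ 0 0 := by
    refine ⟨_, eigen_single Δ b hB _ 0 ?_⟩
    rw [← dT, M, dadd, dsm]
    simp [d1, dsm]
  have hdx : ∀ (α : Δ) (i : ℕ),
      d (x3 Δ α i) = f α • x3 Δ α i + (c * i) • x3 Δ α (i - 1) := by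
    intro α i
    induction i with
    | zero => simp [hf]
    | succ i ih =>
      have h := dmul (x3 Δ α i) (x3 Δ 0 1)
      rw [M, dadd, dsm, dsm, hc, msr, m1, ih, mal, msl, msl, M, M] at h
      simp only [add_zero, ZeroMemClass.coe_zero, zero_add, Nat.cast_one, Nat.add_sub_cancel] at h
      have h2 : b • d (x3 Δ α (i + 1))
          = b • (f α • x3 Δ α (i + 1) + (c * (i + 1 : ℕ)) • x3 Δ α i) := by
        rcases i with _ | i
        · simp only [Nat.cast_zero, zero_add, mul_zero, zero_smul, add_zero, zero_tsub] at h ⊢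
          rw [ih] at h
          simp only [Nat.cast_zero, mul_zero, zero_smul, add_zero] at h
          rw [eq_sub_of_add_eq h]
          push_cast
          module
        · rw [ih] at h
          simp only [Nat.add_sub_cancel] at h
          rw [eq_sub_of_add_eq h]
          push_cast
          module
      simpa using smul_right_injective _ hb0 h2
  -- the relation from `a = 1`
  have rel : ∀ u v, A3mul Δ b (x3 Δ 0 0) (lie u v) = lie (A3mul Δ b (x3 Δ 0 0) u) v
      + lie u (A3mul Δ b (x3 Δ 0 0) v) - A3mul Δ b (d u) v + A3mul Δ b (d v) u := by
    intro u v
    have h := comp (x3 Δ 0 0) u v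
    have e : ∀ w, lie (x3 Δ 0 0) w = (-1 : ℂ) • d w := by
      intro w; rw [hd, skew]; module
    rw [e, e, msl, msl] at h
    rw [skew u (A3mul Δ b (x3 Δ 0 0) v), ← sub_eq_zero, ← neg_eq_zero, ← h]
    module
  refine ⟨AddMonoidHom.mk' (fun α => - f α) (fun α β => by simp only [fadd]; ring), -c, ?_⟩
  intro α β i j
  simp only [AddMonoidHom.mk'_apply]
  induction hn : i + j using Nat.strong_induction_on generalizing i j with
  | _ n ih =>
  rw [← hn]
  obtain ⟨R, hR⟩ : ∃ R : ℕ → ℕ → ((Δ × ℕ) →₀ ℂ), ∀ i j, R i j =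
      ((1 / b) * (((α : ℂ) + b) * -f β - ((β : ℂ) + b) * -f α)) • x3 Δ (α + β) (i + j)
      + ((1 / b) * ((i : ℂ) * (-f β - -c * ((β : ℂ) + b))
              + (j : ℂ) * (-c * ((α : ℂ) + b) - -f α))) • x3 Δ (α + β) (i + j - 1) :=
    ⟨_, fun _ _ => rfl⟩
  have ih' : ∀ i' j', i' + j' < i + j → lie (x3 Δ α i') (x3 Δ β j') = R i' j' := by
    intro i' j' h
    rw [hR]
    exact ih (i' + j') (hn ▸ h) i' j' rfl
  rw [← hR]
  have hL : A3mul Δ b (x3 Δ 0 0) (lie (x3 Δ α i) (x3 Δ β j)) =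
      ((α : ℂ) + β + 2 * b) • lie (x3 Δ α i) (x3 Δ β j) + (i : ℂ) • R (i - 1) j
      + (j : ℂ) • R i (j - 1) - A3mul Δ b (d (x3 Δ α i)) (x3 Δ β j)
      + A3mul Δ b (d (x3 Δ β j)) (x3 Δ α i) := by
    have e1 : (i : ℂ) • R (i - 1) j = (i : ℂ) • lie (x3 Δ α (i - 1)) (x3 Δ β j) := by
      rcases i with _ | i
      · simp
      · rw [ih']; omega
    have e2 : (j : ℂ) • R i (j - 1) = (j : ℂ) • lie (x3 Δ α i) (x3 Δ β (j - 1)) := by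
      rcases j with _ | j
      · simp
      · rw [ih']; omega
    rw [rel, M, M, e1, e2]
    simp only [zero_add, lal, lar, lsl, lsr]
    module
  have hRT : A3mul Δ b (x3 Δ 0 0) (R i j) =
      ((α : ℂ) + β + 2 * b) • R i j + (i : ℂ) • R (i - 1) j
      + (j : ℂ) • R i (j - 1) - A3mul Δ b (d (x3 Δ α i)) (x3 Δ β j)
      + A3mul Δ b (d (x3 Δ β j)) (x3 Δ α i) := by
    rw [hdx, hdx]
    simp only [hR, mar, mal, msl, msr, M, zero_add, add_comm β α, AddSubgroup.coe_add]
    rcases i with _ | i <;> rcases j with _ | j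
    · simp
      match_scalars
      field_simp
      ring
    · simp only [Nat.cast_zero, zero_add, mul_zero, zero_smul, add_zero, zero_mul,
        Nat.add_sub_cancel, Nat.zero_sub]
      match_scalars <;> push_cast <;> field_simp <;> ring
    · simp only [Nat.cast_zero, zero_add, mul_zero, zero_smul, add_zero, zero_mul,
        Nat.add_sub_cancel, Nat.zero_sub]
      match_scalars <;> push_cast <;> field_simp <;> ring
    · simp only [show i + 1 + (j + 1) = i + j + 2 by ring, show i + (j + 1) = i + j + 1 by ring,
        show i + 1 + j = i + j + 1 by ring, show j + 1 + (i + 1) = i + j + 2 by ring,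
        show j + (i + 1) = i + j + 1 by ring, show j + 1 + i = i + j + 1 by ring,
        show i + j + 2 - 1 = i + j + 1 by omega, Nat.add_sub_cancel]
      match_scalars <;> push_cast <;> field_simp <;> ring
  have hE : A3mul Δ b (x3 Δ 0 0) (lie (x3 Δ α i) (x3 Δ β j) - R i j)
      = ((α : ℂ) + β + 2 * b) • (lie (x3 Δ α i) (x3 Δ β j) - R i j) := by
    rw [subl, hL, hRT]
    module
  rw [← sub_eq_zero]
  ext ⟨γ, k⟩
  apply T_eigen Δ b hB _ _ hE
  rintro ⟨h, -⟩
  apply hb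
  rw [show b = ((γ - α - β : Δ) : ℂ) by push_cast; linear_combination -h]
  exact (γ - α - β).2
end
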